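/- (Theorem 5.5, sharpness of the τ1-method inclusion sets for Toeplitz matrices with Wiener-algebra symbol) Suppose ε > 0. Then d_H(Spec_ε A_M, Spec_ε A_∞) → 0 as M → ∞, and for every δ > 0 there exist n_0, M_0, w_0 ∈ ℕ such that d_H(Γ^n_ε(A_M), Spec_ε A_∞) ≤ δ whenever n ≥ n_0, M ≥ M_0, and A_M is written in a block form with N > n and w := min_{1≤i≤N} m_i ≥ w_0; consequently d_H(Γ^n_ε(A_M), Spec_ε A_M) → 0 as M, n, w → ∞. If in addition a_{−j} = conj(a_j) for all j ∈ ℤ, then these conclusions hold also for ε = 0; in particular d_H(Γ^n_0(A_M), Spec A_M) → 0 as M, n, w → ∞. -/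

import Mathlib

open scoped Real

noncomputable section

namespace SpecIncl

/-- The smallest singular value of a (possibly rectangular) complex matrix,
as the infimum of `‖F x‖` over the unit sphere. -/
noncomputable def sval {ι κ : Type*} [Fintype ι] [Fintype κ] [DecidableEq κ]
    (F : Matrix ι κ ℂ) : ℝ :=
  sInf {y : ℝ | ∃ x : EuclideanSpace ℂ κ, ‖x‖ = 1 ∧ y = ‖Matrix.toEuclideanLin F x‖}

/-- The spectral norm (2-norm) of a complex matrix. -/
noncomputable def opNorm {ι κ : Type*} [Fintype ι] [Fintype κ] [DecidableEq κ]
    (F : Matrix ι κ ℂ) : ℝ :=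
  sSup {y : ℝ | ∃ x : EuclideanSpace ℂ κ, ‖x‖ = 1 ∧ y = ‖Matrix.toEuclideanLin F x‖}

/-- The closed ε-pseudospectrum of a square complex matrix. -/
noncomputable def pspec {ι : Type*} [Fintype ι] [DecidableEq ι] (ε : ℝ)
    (E : Matrix ι ι ℂ) : Set ℂ :=
  {z : ℂ | sval (E - z • (1 : Matrix ι ι ℂ)) ≤ ε}

/-- Assemble blocks into a block matrix indexed by a sigma type. -/
def blockMat {N : ℕ} (m : Fin N → ℕ)
    (a : ∀ i j : Fin N, Matrix (Fin (m i)) (Fin (m j)) ℂ) :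
    Matrix ((i : Fin N) × Fin (m i)) ((j : Fin N) × Fin (m j)) ℂ :=
  fun p q => a p.1 q.1 p.2 q.2

/-- The block-tridiagonal part of a block matrix. -/
def triPart {N : ℕ} {m : Fin N → ℕ}
    (a : ∀ i j : Fin N, Matrix (Fin (m i)) (Fin (m j)) ℂ) :
    ∀ i j : Fin N, Matrix (Fin (m i)) (Fin (m j)) ℂ :=
  fun i j => if |(i : ℤ) - (j : ℤ)| ≤ 1 then a i j else 0

/-- The remaining (off-tridiagonal) part of a block matrix. -/
def remPart {N : ℕ} {m : Fin N → ℕ}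
    (a : ∀ i j : Fin N, Matrix (Fin (m i)) (Fin (m j)) ℂ) :
    ∀ i j : Fin N, Matrix (Fin (m i)) (Fin (m j)) ℂ :=
  fun i j => if |(i : ℤ) - (j : ℤ)| ≤ 1 then 0 else a i j

/-- r_L(A): max of the norms of the first-subdiagonal blocks. -/
noncomputable def rL {N : ℕ} {m : Fin N → ℕ}
    (a : ∀ i j : Fin N, Matrix (Fin (m i)) (Fin (m j)) ℂ) : ℝ :=
  sSup {y : ℝ | ∃ i j : Fin N, (j : ℕ) + 1 = (i : ℕ) ∧ y = opNorm (a i j)}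

/-- r_U(A): max of the norms of the first-superdiagonal blocks. -/
noncomputable def rU {N : ℕ} {m : Fin N → ℕ}
    (a : ∀ i j : Fin N, Matrix (Fin (m i)) (Fin (m j)) ℂ) : ℝ :=
  sSup {y : ℝ | ∃ i j : Fin N, (i : ℕ) + 1 = (j : ℕ) ∧ y = opNorm (a i j)}

noncomputable def rA {N : ℕ} {m : Fin N → ℕ}
    (a : ∀ i j : Fin N, Matrix (Fin (m i)) (Fin (m j)) ℂ) : ℝ :=
  rL a + rU a

/-- θ_n for the coefficient `c = r_L r_U / r²`: the unique solution of
`2 sin(t/2) cos((n+1/2)t) + c sin((n−1)t) = 0` in `[π/(2n+1), π/(n+2)]`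
(by uniqueness, equal to the infimum of the solution set). -/
noncomputable def theta (c : ℝ) (n : ℕ) : ℝ :=
  sInf {t : ℝ | t ∈ Set.Icc (Real.pi / (2 * (n : ℝ) + 1)) (Real.pi / ((n : ℝ) + 2)) ∧
    2 * Real.sin (t / 2) * Real.cos (((n : ℝ) + 1 / 2) * t)
      + c * Real.sin (((n : ℝ) - 1) * t) = 0}

/-- ε_n(A) := 2 r(A) sin(θ_n(A)/2) + ‖C‖. -/
noncomputable def epsTau {N : ℕ} {m : Fin N → ℕ}
    (a : ∀ i j : Fin N, Matrix (Fin (m i)) (Fin (m j)) ℂ) (n : ℕ) : ℝ :=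
  2 * rA a * Real.sin (theta (rL a * rU a / (rA a) ^ 2) n / 2)
    + opNorm (blockMat m (remPart a))

/-- The index `k + i` in `Fin N` (0-based window of length `n` starting at `k`). -/
def widx {N n k : ℕ} (h : k + n ≤ N) (i : Fin n) : Fin N :=
  ⟨k + i, by have := i.isLt; omega⟩

/-- The principal submatrix `B_{n,k}` of a block matrix, with block rows and
columns `k+1,…,k+n` (1-based), i.e. `k,…,k+n-1` (0-based). -/
def window {N : ℕ} {m : Fin N → ℕ}
    (b : ∀ i j : Fin N, Matrix (Fin (m i)) (Fin (m j)) ℂ)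
    (n k : ℕ) (h : k + n ≤ N) :
    Matrix ((i : Fin n) × Fin (m (widx h i))) ((j : Fin n) × Fin (m (widx h j))) ℂ :=
  fun p q => b (widx h p.1) (widx h q.1) p.2 q.2

/-- σ^n_ε(A) of the τ-method. -/
noncomputable def sigmaLow {N : ℕ} {m : Fin N → ℕ}
    (a : ∀ i j : Fin N, Matrix (Fin (m i)) (Fin (m j)) ℂ)
    (n : ℕ) (h : n ≤ N) (ε : ℝ) : Set ℂ :=
  (⋃ k : Fin (N - n + 1),
      pspec (ε + epsTau a n)
        (window (triPart a) n k (by have := k.isLt; omega))) ∪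
  (⋃ m' : Fin (n - 1),
      pspec (ε + epsTau a n)
        (window (triPart a) (m' + 1) 0 (by have := m'.isLt; omega)) ∪
      pspec (ε + epsTau a n)
        (window (triPart a) (m' + 1) (N - (m' + 1)) (by have := m'.isLt; omega)))

/-- σ̂^n_ε(A) of the τ-method. -/
noncomputable def sigmaHat {N : ℕ} {m : Fin N → ℕ}
    (a : ∀ i j : Fin N, Matrix (Fin (m i)) (Fin (m j)) ℂ)
    (n : ℕ) (h : n ≤ N) (ε : ℝ) : Set ℂ :=
  ⋃ k : Fin (N - n + 1),
    pspec (ε + epsTau a (n - 2))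
      (window (triPart a) n k (by have := k.isLt; omega))

/-- The τ-method inclusion set Σ^n_ε(A). -/
noncomputable def SigmaTau {N : ℕ} {m : Fin N → ℕ}
    (a : ∀ i j : Fin N, Matrix (Fin (m i)) (Fin (m j)) ℂ)
    (n : ℕ) (h : n ≤ N) (ε : ℝ) : Set ℂ :=
  if n ≤ 2 then sigmaLow a n h ε else sigmaLow a n h ε ∩ sigmaHat a n h ε


/-- The row size of the extended block structure: `m i` for `0 ≤ i < N`
(0-based), and `1` (the paper's `1 × m` zero-block convention) otherwise. -/
def rsz {N : ℕ} (m : Fin N → ℕ) (i : ℤ) : ℕ :=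
  if h : 0 ≤ i ∧ i < N then m ⟨i.toNat, by omega⟩ else 1

/-- Scalar access to a block matrix extended by zeros outside the index
range `{0,…,N−1}` (0-based). -/
noncomputable def sb {N : ℕ} {m : Fin N → ℕ}
    (b : ∀ i j : Fin N, Matrix (Fin (m i)) (Fin (m j)) ℂ)
    (i j : ℤ) (α β : ℕ) : ℂ :=
  if hi : 0 ≤ i ∧ i < N then
    if hj : 0 ≤ j ∧ j < N then
      if hα : α < m ⟨i.toNat, by omega⟩ then
        if hβ : β < m ⟨j.toNat, by omega⟩ then
          b ⟨i.toNat, by omega⟩ ⟨j.toNat, by omega⟩ ⟨α, hα⟩ ⟨β, hβ⟩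
        else 0
      else 0
    else 0
  else 0

/-- The rectangular one-sided truncation `B^+_{n,k}`: the `(n+2) × n` block
matrix with first block row `(b_{k,k+1}, 0, …, 0)`, middle part `B_{n,k}`, and
last block row `(0, …, 0, b_{k+n+1,k+n})` (1-based indices as in the paper). -/
noncomputable def Bplus {N : ℕ} {m : Fin N → ℕ}
    (b : ∀ i j : Fin N, Matrix (Fin (m i)) (Fin (m j)) ℂ)
    (n k : ℕ) (h : k + n ≤ N) :
    Matrix ((i : Fin (n + 2)) × Fin (rsz m ((k : ℤ) - 1 + i)))
      ((j : Fin n) × Fin (m (widx h j))) ℂ :=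
  fun p q => sb b ((k : ℤ) - 1 + p.1) ((k : ℤ) + q.1) p.2 q.2

/-- The rectangular matrix `I⁺_n` whose middle `n × n` block part is the
identity and whose first and last block rows are zero. -/
noncomputable def IplusMat {N : ℕ} (m : Fin N → ℕ)
    (n k : ℕ) (h : k + n ≤ N) :
    Matrix ((i : Fin (n + 2)) × Fin (rsz m ((k : ℤ) - 1 + i)))
      ((j : Fin n) × Fin (m (widx h j))) ℂ :=
  fun p q => if (p.1 : ℕ) = (q.1 : ℕ) + 1 ∧ (p.2 : ℕ) = (q.2 : ℕ) then 1 else 0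

/-- ε''_n(A) := 2 r(A) sin(π/(2n+2)) + ‖C‖. -/
noncomputable def epsTau1 {N : ℕ} {m : Fin N → ℕ}
    (a : ∀ i j : Fin N, Matrix (Fin (m i)) (Fin (m j)) ℂ) (n : ℕ) : ℝ :=
  2 * rA a * Real.sin (Real.pi / (2 * (n : ℝ) + 2))
    + opNorm (blockMat m (remPart a))

/-- The τ₁-method inclusion set Γ^n_ε(A): the union over `k` of the closed
`(ε+ε''_n(A))`-pseudospectra of the rectangular matrices `B^+_{n,k}`. -/
lemma kwin {N n : ℕ} (h : n ≤ N) (k : Fin (N - n + 1)) : (k : ℕ) + n ≤ N := by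
  have := k.isLt; omega

noncomputable def GammaTau1 {N : ℕ} {m : Fin N → ℕ}
    (a : ∀ i j : Fin N, Matrix (Fin (m i)) (Fin (m j)) ℂ)
    (n : ℕ) (h : n ≤ N) (ε : ℝ) : Set ℂ :=
  ⋃ k : Fin (N - n + 1),
    {z : ℂ | sval (Bplus (triPart a) n k (kwin h k)
        - z • IplusMat m n k (kwin h k)) ≤ ε + epsTau1 a n}


/-- The starting (0-based) row/column index of block `i` in the block
decomposition with block sizes `m`. -/
def offset {N : ℕ} (m : Fin N → ℕ) (i : Fin N) : ℕ :=
  ∑ j ∈ Finset.univ.filter (fun j => j < i), m j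

lemma offset_add_lt {N M : ℕ} {m : Fin N → ℕ} (hsum : ∑ i, m i = M)
    (i : Fin N) (α : Fin (m i)) : offset m i + (α : ℕ) < M := by
  have h3 := Finset.sum_le_sum_of_subset
    (Finset.subset_univ (insert i (Finset.univ.filter (fun j => j < i)))) (f := m)
  rw [Finset.sum_insert (by simp)] at h3
  have := α.isLt
  unfold offset
  omega

/-- The block decomposition of an `M × M` matrix with block sizes `m`
(summing to `M`). -/
def blocksOf {M N : ℕ} (A : Matrix (Fin M) (Fin M) ℂ) (m : Fin N → ℕ)
    (hsum : ∑ i, m i = M) : ∀ i j : Fin N, Matrix (Fin (m i)) (Fin (m j)) ℂ :=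
  fun i j α β =>
    A ⟨offset m i + α, offset_add_lt hsum i α⟩ ⟨offset m j + β, offset_add_lt hsum j β⟩

/-- The order-`M` Toeplitz matrix with symbol coefficients `a`. -/
def ToepM (a : ℤ → ℂ) (M : ℕ) : Matrix (Fin M) (Fin M) ℂ :=
  fun i j => a ((i : ℤ) - (j : ℤ))

/-- The band-width `w_M` of the order-`M` Toeplitz matrix: the least `v` such
that all its entries vanish at distance more than `v` from the diagonal. -/
noncomputable def bandWidth (a : ℤ → ℂ) (M : ℕ) : ℕ :=
  sInf {v : ℕ | ∀ i j : Fin M, (v : ℤ) < |(i : ℤ) - (j : ℤ)| →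
    a ((i : ℤ) - (j : ℤ)) = 0}

/-- The closed ε-pseudospectrum of a bounded operator, with the convention
`‖(T−λI)^{−1}‖^{−1} := 0` when `T − λI` is not boundedly invertible
(`Ring.inverse` is `0` on non-units and `(0:ℝ)⁻¹ = 0`). -/
noncomputable def pspecOp {H : Type*} [NormedAddCommGroup H] [NormedSpace ℂ H]
    (ε : ℝ) (T : H →L[ℂ] H) : Set ℂ :=
  {z : ℂ | ‖Ring.inverse (T - z • (1 : H →L[ℂ] H))‖⁻¹ ≤ ε}

end SpecIncl

namespace SpecIncl

section Operator

variable {H : Type*} [NormedAddCommGroup H] [InnerProductSpace ℂ H]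

lemma norm_inverse_inv_lt_of_lt {S : H →L[ℂ] H} {c : ℝ} {x : H}
    (hx : ‖S x‖ < c * ‖x‖) (hc : 0 < c) : ‖Ring.inverse S‖⁻¹ < c := by
  by_cases hS : IsUnit S
  · have hx0 : x ≠ 0 := by rintro rfl; simp at hx
    have hpos : 0 < ‖x‖ := norm_pos_iff.2 hx0
    have h1 : Ring.inverse S (S x) = x := by
      have := Ring.inverse_mul_cancel S hS
      simpa using congrArg (fun F : H →L[ℂ] H => F x) this
    have h2 := (Ring.inverse S).le_opNorm (S x)
    rw [h1] at h2
    have hR : 0 < ‖Ring.inverse S‖ := by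
      rcases (norm_nonneg (Ring.inverse S)).eq_or_lt with h | h
      · rw [← h] at h2; linarith
      · exact h
    rw [inv_lt_comm₀ hR hc, ← one_div, div_lt_iff₀ hc]
    by_contra hcon
    push Not at hcon
    have : ‖Ring.inverse S‖ * ‖S x‖ < ‖x‖ := by
      calc _ < ‖Ring.inverse S‖ * (c * ‖x‖) := by gcongr
        _ ≤ _ := by nlinarith
    linarith
  · rw [Ring.inverse_non_unit _ hS]; simpa using hc

lemma le_norm_inverse_inv [Nontrivial H] {S : H →L[ℂ] H} {c : ℝ} (hc : 0 < c) (hS : IsUnit S)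
    (h : ∀ x, c * ‖x‖ ≤ ‖S x‖) : c ≤ ‖Ring.inverse S‖⁻¹ := by
  have h1 := Ring.mul_inverse_cancel S hS
  have hR : 0 < ‖Ring.inverse S‖ := by
    rw [norm_pos_iff]
    intro h0
    rw [h0, mul_zero] at h1
    exact zero_ne_one h1
  rw [le_inv_comm₀ hc hR]
  refine ContinuousLinearMap.opNorm_le_bound _ (inv_pos.2 hc).le (fun y => ?_)
  have h2 := h (Ring.inverse S y)
  have h3 : S (Ring.inverse S y) = y := by
    simpa using congrArg (fun F : H →L[ℂ] H => F y) h1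
  rw [h3] at h2
  rw [inv_mul_eq_div, le_div_iff₀ hc]
  linarith

/-- Averaging over the fourth roots of unity. -/
lemma exists_le_norm_sq_add (u v w : H) (r : ℝ) :
    ∃ h : ℂ, ‖h‖ = |r| ∧ ‖u‖ ^ 2 + r ^ 2 * ‖v‖ ^ 2 ≤ ‖u + h • v + h ^ 2 • w‖ ^ 2 := by
  have par : ∀ x y : H, ‖x + y‖ ^ 2 + ‖x - y‖ ^ 2 = 2 * (‖x‖ ^ 2 + ‖y‖ ^ 2) := by
    intro x y
    have := parallelogram_law_with_norm ℂ x y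
    nlinarith
  by_contra! hcon
  have e1 := hcon (r : ℂ) (by simp)
  have e2 := hcon (-(r : ℂ)) (by simp)
  have e3 := hcon (Complex.I * r) (by simp)
  have e4 := hcon (-(Complex.I * r)) (by simp)
  have p1 := par (u + (r ^ 2 : ℂ) • w) ((r : ℂ) • v)
  have p2 := par (u - (r ^ 2 : ℂ) • w) ((Complex.I * r : ℂ) • v)
  have p3 := par u ((r ^ 2 : ℂ) • w)
  have q1 : u + (r ^ 2 : ℂ) • w + (r : ℂ) • v = u + (r : ℂ) • v + (r : ℂ) ^ 2 • w := by module
  have q2 : u + (r ^ 2 : ℂ) • w - (r : ℂ) • v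
      = u + (-(r : ℂ)) • v + (-(r : ℂ)) ^ 2 • w := by module
  have hI : (Complex.I * (r : ℂ)) ^ 2 = -(r : ℂ) ^ 2 := by rw [mul_pow, Complex.I_sq]; ring
  have hI' : (-(Complex.I * (r : ℂ))) ^ 2 = -(r : ℂ) ^ 2 := by rw [neg_sq, hI]
  have q3 : u - (r ^ 2 : ℂ) • w + (Complex.I * r : ℂ) • v
      = u + (Complex.I * r) • v + (Complex.I * (r : ℂ)) ^ 2 • w := by rw [hI]; module
  have q4 : u - (r ^ 2 : ℂ) • w - (Complex.I * r : ℂ) • v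
      = u + (-(Complex.I * r)) • v + (-(Complex.I * (r : ℂ))) ^ 2 • w := by rw [hI']; module
  rw [q1, q2] at p1
  rw [q3, q4] at p2
  have n1 : ‖(r : ℂ) • v‖ ^ 2 = r ^ 2 * ‖v‖ ^ 2 := by
    rw [norm_smul, mul_pow]; simp
  have n2 : ‖(Complex.I * r : ℂ) • v‖ ^ 2 = r ^ 2 * ‖v‖ ^ 2 := by
    rw [norm_smul, mul_pow]; simp
  rw [n1] at p1
  rw [n2] at p2
  nlinarith [sq_nonneg ‖(r ^ 2 : ℂ) • w‖]

variable [CompleteSpace H]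

/-- Some vector is contracted by a factor less than `c` by `T - z` or by its adjoint. -/
def Shrinks (T : H →L[ℂ] H) (c : ℝ) (z : ℂ) : Prop :=
  (∃ x, ‖(T - z • (1 : H →L[ℂ] H)) x‖ < c * ‖x‖) ∨
    ∃ x, ‖(star (T - z • (1 : H →L[ℂ] H))) x‖ < c * ‖x‖

/-- An operator that is bounded below together with its adjoint is invertible. -/
lemma isUnit_of_bounded_below {S : H →L[ℂ] H} {c : ℝ} (hc : 0 < c)
    (h₁ : ∀ x, c * ‖x‖ ≤ ‖S x‖) (h₂ : ∀ x, c * ‖x‖ ≤ ‖star S x‖) : IsUnit S := by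
  rw [ContinuousLinearMap.isUnit_iff_bijective,
    ContinuousLinearMap.bijective_iff_dense_range_and_antilipschitz]
  refine ⟨?_, c.toNNReal⁻¹, S.antilipschitz_of_bound fun x => ?_⟩
  · rw [Submodule.topologicalClosure_eq_top_iff, Submodule.eq_bot_iff]
    intro x hx
    rw [ContinuousLinearMap.orthogonal_range] at hx
    have hx' : star S x = 0 := hx
    have := h₂ x
    rw [hx', norm_zero] at this
    have : ‖x‖ ≤ 0 := by nlinarith [norm_nonneg x]
    simpa using this
  · rw [NNReal.coe_inv, Real.coe_toNNReal c hc.le, inv_mul_eq_div, le_div_iff₀ hc]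
    linarith [h₁ x]

lemma shrinks_mono {T : H →L[ℂ] H} {c d : ℝ} {z : ℂ} (hcd : c ≤ d) (h : Shrinks T c z) :
    Shrinks T d z := by
  rcases h with ⟨x, hx⟩ | ⟨x, hx⟩
  · exact Or.inl ⟨x, hx.trans_le (by gcongr)⟩
  · exact Or.inr ⟨x, hx.trans_le (by gcongr)⟩

lemma shrinks_of_dist {T : H →L[ℂ] H} {c : ℝ} {z w : ℂ} (h : Shrinks T c z) :
    Shrinks T (c + ‖z - w‖) w := by
  rcases h with ⟨x, hx⟩ | ⟨x, hx⟩
  · refine Or.inl ⟨x, ?_⟩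
    have : (T - w • (1 : H →L[ℂ] H)) x = (T - z • (1 : H →L[ℂ] H)) x + (z - w) • x := by
      simp only [sub_apply, smul_apply,
        one_apply_eq_self]
      module
    rw [this]
    calc _ ≤ _ := norm_add_le _ _
      _ < _ := by rw [norm_smul, add_mul]; linarith
  · refine Or.inr ⟨x, ?_⟩
    have : (star (T - w • (1 : H →L[ℂ] H))) x
        = (star (T - z • (1 : H →L[ℂ] H))) x + (star (z - w)) • x := by
      simp only [star_sub, star_smul, star_one,
        sub_apply, smul_apply,
        one_apply_eq_self]
      module
    rw [this]
    calc _ ≤ _ := norm_add_le _ _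
      _ < _ := by rw [norm_smul, norm_star, add_mul]; linarith

lemma norm_lt_of_shrinks {T : H →L[ℂ] H} {c : ℝ} {z : ℂ} (h : Shrinks T c z) :
    ‖z‖ < ‖T‖ + c := by
  rcases h with ⟨x, hx⟩ | ⟨x, hx⟩
  · have hx0 : x ≠ 0 := by rintro rfl; simp at hx
    have hpos : 0 < ‖x‖ := norm_pos_iff.2 hx0
    have h1 : z • x = T x - (T - z • (1 : H →L[ℂ] H)) x := by simp
    have h2 := norm_sub_le (T x) ((T - z • (1 : H →L[ℂ] H)) x)
    rw [← h1, norm_smul] at h2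
    have h3 := T.le_opNorm x
    nlinarith
  · have hx0 : x ≠ 0 := by rintro rfl; simp at hx
    have hpos : 0 < ‖x‖ := norm_pos_iff.2 hx0
    have h1 : star z • x = star T x - (star (T - z • (1 : H →L[ℂ] H))) x := by simp
    have h2 := norm_sub_le (star T x) ((star (T - z • (1 : H →L[ℂ] H))) x)
    rw [← h1, norm_smul, norm_star] at h2
    have h3 := (star T).le_opNorm x
    rw [norm_star] at h3
    nlinarith

lemma norm_inverse_star (S : H →L[ℂ] H) : ‖Ring.inverse (star S)‖ = ‖Ring.inverse S‖ := by
  rw [Ring.inverse_star, norm_star]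

lemma mem_pspecOp_iff [Nontrivial H] {T : H →L[ℂ] H} {ε : ℝ} (hε : 0 ≤ ε) {z : ℂ} :
    z ∈ pspecOp ε T ↔ ∀ c, ε < c → Shrinks T c z := by
  constructor
  · intro hz c hc
    by_contra hcon
    unfold Shrinks at hcon
    push Not at hcon
    have hc0 : 0 < c := hε.trans_lt hc
    have hu := isUnit_of_bounded_below hc0 hcon.1 hcon.2
    have := le_norm_inverse_inv hc0 hu hcon.1
    have hz' : ‖Ring.inverse (T - z • (1 : H →L[ℂ] H))‖⁻¹ ≤ ε := hz
    linarith
  · intro h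
    change ‖Ring.inverse (T - z • (1 : H →L[ℂ] H))‖⁻¹ ≤ ε
    refine le_of_forall_gt_imp_ge_of_dense (fun c hc => ?_)
    have hc0 : 0 < c := hε.trans_lt hc
    rcases h c hc with ⟨x, hx⟩ | ⟨x, hx⟩
    · exact (norm_inverse_inv_lt_of_lt hx hc0).le
    · rw [← norm_inverse_star]
      exact (norm_inverse_inv_lt_of_lt hx hc0).le

/-- Upper semicontinuity of the pseudospectrum in the level. -/
lemma exists_pspecOp_subset_thickening [Nontrivial H] (T : H →L[ℂ] H) {ε δ : ℝ} (hε : 0 ≤ ε)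
    (hδ : 0 < δ) : ∃ η > 0, ∀ z, Shrinks T (ε + η) z → ∃ w ∈ pspecOp ε T, ‖z - w‖ ≤ δ := by
  by_contra! hcon
  have hpos : ∀ k : ℕ, (0 : ℝ) < 1 / ((k : ℝ) + 1) := fun k => by positivity
  choose z hz hzd using fun k : ℕ => hcon _ (hpos k)
  have hbd : ∀ k, z k ∈ Metric.closedBall (0 : ℂ) (‖T‖ + (ε + 1)) := by
    intro k
    rw [mem_closedBall_zero_iff]
    have h1 := norm_lt_of_shrinks (hz k)
    have h2 : 1 / ((k : ℝ) + 1) ≤ 1 := by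
      rw [div_le_one (by positivity)]; linarith [Nat.cast_nonneg (α := ℝ) k]
    linarith
  obtain ⟨w, -, φ, hφ, hlim⟩ := (isCompact_closedBall (0 : ℂ) (‖T‖ + (ε + 1))).tendsto_subseq hbd
  have hd : Filter.Tendsto (fun k => ‖z (φ k) - w‖) Filter.atTop (nhds 0) :=
    tendsto_iff_norm_sub_tendsto_zero.1 hlim
  have hw : w ∈ pspecOp ε T := by
    rw [mem_pspecOp_iff hε]
    intro c hc
    have h1 : Filter.Tendsto (fun k => ε + 1 / ((φ k : ℝ) + 1) + ‖z (φ k) - w‖) Filter.atTop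
        (nhds (ε + 0 + 0)) :=
      (tendsto_const_nhds.add
        (tendsto_one_div_add_atTop_nhds_zero_nat.comp hφ.tendsto_atTop)).add hd
    have h2 := h1.eventually (gt_mem_nhds (show ε + 0 + 0 < c by linarith))
    obtain ⟨k, hk⟩ := h2.exists
    exact shrinks_mono hk.le (shrinks_of_dist (hz (φ k)))
  obtain ⟨k, hk⟩ := (hd.eventually (gt_mem_nhds hδ)).exists
  exact absurd (hzd (φ k) w hw) (by linarith)

/-- The resolvent norm has no local maximum: close to each point of a pseudospectrum of positive
level there are points of strictly smaller level. -/
lemma exists_shrinks_near [Nontrivial H] (T : H →L[ℂ] H) {ε δ : ℝ} (hε : 0 < ε) (hδ : 0 < δ)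
    {z : ℂ} (hz : z ∈ pspecOp ε T) : ∃ w, ‖z - w‖ ≤ δ ∧ Shrinks T ε w := by
  set S : H →L[ℂ] H := T - z • (1 : H →L[ℂ] H) with hSdef
  by_cases hS : IsUnit S
  swap
  · refine ⟨z, by simpa using hδ.le, ?_⟩
    by_contra hcon
    unfold Shrinks at hcon
    push Not at hcon
    exact hS (isUnit_of_bounded_below hε hcon.1 hcon.2)
  set R := Ring.inverse S with hR
  have hSR : ∀ y, S (R y) = y := fun y => by
    simpa using congrArg (fun F : H →L[ℂ] H => F y) (Ring.mul_inverse_cancel S hS)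
  have hRS : ∀ y, R (S y) = y := fun y => by
    simpa using congrArg (fun F : H →L[ℂ] H => F y) (Ring.inverse_mul_cancel S hS)
  have hS0 : 0 < ‖S‖ := by
    rw [norm_pos_iff]; rintro h0
    obtain ⟨y, hy⟩ := exists_ne (0 : H)
    exact hy (by rw [← hSR y, h0]; simp)
  set b := ‖S‖ with hb
  set D := 1 + ‖R‖ ^ 2 with hD
  have hev : ∀ᶠ r : ℝ in nhdsWithin 0 (Set.Ioi 0),
      2 * ε * r * D + r ^ 4 * D ^ 2 < ε ^ 2 / b ^ 2 := by
    have hc : Continuous (fun r : ℝ => 2 * ε * r * D + r ^ 4 * D ^ 2) := by fun_prop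
    have h0 := hc.tendsto 0
    simp only [mul_zero, zero_mul, ne_eq, OfNat.ofNat_ne_zero, not_false_eq_true, zero_pow,
      add_zero] at h0
    exact (h0.eventually (gt_mem_nhds (by positivity))).filter_mono nhdsWithin_le_nhds
  have hev2 : ∀ᶠ r : ℝ in nhdsWithin 0 (Set.Ioi 0), r < δ :=
    (gt_mem_nhds hδ).filter_mono nhdsWithin_le_nhds
  obtain ⟨r, ⟨hr1, hr2⟩, hr0⟩ := ((hev.and hev2).and self_mem_nhdsWithin).exists
  have hr0 : 0 < r := hr0
  obtain ⟨x, hx⟩ : ∃ x, ‖S x‖ < (ε + r ^ 3) * ‖x‖ := by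
    by_contra! hcon
    have h1 := le_norm_inverse_inv (by positivity) hS hcon
    have h2 : ‖Ring.inverse S‖⁻¹ ≤ ε := hz
    have : 0 < r ^ 3 := by positivity
    linarith
  have hx0 : x ≠ 0 := by rintro rfl; simp at hx
  have hpos : 0 < ‖x‖ := norm_pos_iff.2 hx0
  obtain ⟨h, hh, hn⟩ := exists_le_norm_sq_add x (R x) (R (R x)) r
  rw [abs_of_pos hr0] at hh
  refine ⟨z + h, by simp [hh, hr2.le], Or.inl ⟨x + h • R x + h ^ 2 • R (R x), ?_⟩⟩
  have hval : (T - (z + h) • (1 : H →L[ℂ] H)) (x + h • R x + h ^ 2 • R (R x))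
      = S x - h ^ 3 • R (R x) := by
    have : T - (z + h) • (1 : H →L[ℂ] H) = S - h • (1 : H →L[ℂ] H) := by
      rw [hSdef]; module
    rw [this]
    simp only [sub_apply, smul_apply,
      one_apply_eq_self, map_add, map_smul, hSR]
    module
  have hRR : ‖R (R x)‖ ≤ ‖R‖ ^ 2 * ‖x‖ := by
    calc _ ≤ ‖R‖ * ‖R x‖ := R.le_opNorm _
      _ ≤ ‖R‖ * (‖R‖ * ‖x‖) := by gcongr; exact R.le_opNorm _
      _ = _ := by ring
  have hnum : ‖S x - h ^ 3 • R (R x)‖ < (ε + r ^ 3 * D) * ‖x‖ := by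
    calc _ ≤ ‖S x‖ + r ^ 3 * ‖R (R x)‖ := by
          refine (norm_sub_le _ _).trans ?_
          rw [norm_smul, norm_pow, hh]
      _ ≤ ‖S x‖ + r ^ 3 * (‖R‖ ^ 2 * ‖x‖) := by gcongr
      _ < _ := by rw [hD]; linarith
  rw [hval]
  have hlow : ‖x‖ / b ≤ ‖R x‖ := by
    rw [div_le_iff₀ hS0]
    have := S.le_opNorm (R x)
    rw [hSR] at this
    linarith
  have hlow2 : ‖x‖ ^ 2 / b ^ 2 ≤ ‖R x‖ ^ 2 := by
    rw [← div_pow]; gcongr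
  refine hnum.trans ?_
  apply lt_of_pow_lt_pow_left₀ 2 (by positivity)
  rw [mul_pow, mul_pow]
  have hfac : (ε + r ^ 3 * D) ^ 2 < ε ^ 2 * (1 + r ^ 2 / b ^ 2) := by
    have : r ^ 2 * (2 * ε * r * D + r ^ 4 * D ^ 2) < r ^ 2 * (ε ^ 2 / b ^ 2) := by gcongr
    have e : ε ^ 2 * (1 + r ^ 2 / b ^ 2) = ε ^ 2 + r ^ 2 * (ε ^ 2 / b ^ 2) := by ring
    rw [e]
    nlinarith
  calc _ < ε ^ 2 * (1 + r ^ 2 / b ^ 2) * ‖x‖ ^ 2 := by gcongr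
    _ = ε ^ 2 * (‖x‖ ^ 2 + r ^ 2 * (‖x‖ ^ 2 / b ^ 2)) := by ring
    _ ≤ ε ^ 2 * (‖x‖ ^ 2 + r ^ 2 * ‖R x‖ ^ 2) := by gcongr
    _ ≤ _ := by gcongr

end Operator

end SpecIncl

namespace SpecIncl

section Finite

open Matrix

variable {ι κ : Type*} [Fintype ι] [Fintype κ]

/-- The Euclidean norm of a finite family of complex numbers. -/
def l2 (x : ι → ℂ) : ℝ := ‖(WithLp.toLp 2 x : EuclideanSpace ℂ ι)‖

lemma l2_sq (x : ι → ℂ) : l2 x ^ 2 = ∑ i, ‖x i‖ ^ 2 := by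
  unfold l2
  rw [EuclideanSpace.norm_sq_eq]

lemma l2_nonneg (x : ι → ℂ) : 0 ≤ l2 x := norm_nonneg _

lemma l2_pos {x : ι → ℂ} (hx : x ≠ 0) : 0 < l2 x := by
  unfold l2
  rw [norm_pos_iff]
  simpa using hx

lemma ne_zero_of_l2_pos {x : ι → ℂ} (hx : 0 < l2 x) : x ≠ 0 := by
  rintro rfl
  simp [l2] at hx

lemma l2_zero : l2 (0 : ι → ℂ) = 0 := by simp [l2]

lemma l2_add_le (x y : ι → ℂ) : l2 (x + y) ≤ l2 x + l2 y := by
  unfold l2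
  rw [WithLp.toLp_add]
  exact norm_add_le _ _

lemma l2_neg (x : ι → ℂ) : l2 (-x) = l2 x := by
  unfold l2
  rw [WithLp.toLp_neg, norm_neg]

lemma l2_le {x : ι → ℂ} {c : ℝ} (hc : 0 ≤ c) (h : ∑ i, ‖x i‖ ^ 2 ≤ c ^ 2) : l2 x ≤ c := by
  rw [← l2_sq] at h
  exact le_of_sq_le_sq h hc

lemma l2_comp {e : ι → κ} (he : Function.Injective e) {y : κ → ℂ}
    (hy : ∀ p, p ∉ Set.range e → y p = 0) : l2 (y ∘ e) = l2 y := by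
  rw [← sq_eq_sq₀ (l2_nonneg _) (l2_nonneg _), l2_sq, l2_sq]
  exact Fintype.sum_of_injective e he _ _ (fun p hp => by simp [hy p hp]) (fun _ => rfl)

/-- The Schur test. -/
lemma l2_mulVec_le_of_sums {F : Matrix ι κ ℂ} {t : ℝ} (ht : 0 ≤ t)
    (hrow : ∀ p, ∑ q, ‖F p q‖ ≤ t) (hcol : ∀ q, ∑ p, ‖F p q‖ ≤ t) (x : κ → ℂ) :
    l2 (F *ᵥ x) ≤ t * l2 x := by
  refine l2_le (mul_nonneg ht (l2_nonneg x)) ?_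
  have hentry : ∀ p, ‖(F *ᵥ x) p‖ ^ 2 ≤ t * ∑ q, ‖F p q‖ * ‖x q‖ ^ 2 := by
    intro p
    have h1 : ‖(F *ᵥ x) p‖ ≤ ∑ q, ‖F p q‖ * ‖x q‖ := by
      refine (norm_sum_le _ _).trans_eq ?_
      simp
    have h2 : (∑ q, ‖F p q‖ * ‖x q‖) ^ 2 ≤ (∑ q, ‖F p q‖) * ∑ q, ‖F p q‖ * ‖x q‖ ^ 2 := by
      refine Finset.sum_sq_le_sum_mul_sum_of_sq_le_mul _ (fun _ _ => norm_nonneg _)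
        (fun _ _ => by positivity) (fun q _ => le_of_eq (by ring))
    calc _ ≤ (∑ q, ‖F p q‖ * ‖x q‖) ^ 2 := by gcongr
      _ ≤ _ := h2
      _ ≤ _ := by
        refine mul_le_mul_of_nonneg_right (hrow p) (Finset.sum_nonneg fun _ _ => by positivity)
  calc _ ≤ ∑ p, t * ∑ q, ‖F p q‖ * ‖x q‖ ^ 2 := Finset.sum_le_sum fun p _ => hentry p
    _ = t * ∑ q, (∑ p, ‖F p q‖) * ‖x q‖ ^ 2 := by
      rw [← Finset.mul_sum, Finset.sum_comm]
      simp_rw [Finset.sum_mul]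
    _ ≤ t * ∑ q, t * ‖x q‖ ^ 2 := by
      gcongr with q
      exact hcol q
    _ = _ := by rw [← Finset.mul_sum, mul_pow, l2_sq]; ring

/-- A matrix dominated by a Laurent matrix is bounded by the Wiener norm. -/
lemma l2_mulVec_le_tsum {F : Matrix ι κ ℂ} {f : ι → ℤ} {g : κ → ℤ} (hf : Function.Injective f)
    (hg : Function.Injective g) {b : ℤ → ℝ} (hb0 : ∀ j, 0 ≤ b j) (hb : Summable b)
    (hF : ∀ p q, ‖F p q‖ ≤ b (f p - g q)) (x : κ → ℂ) :
    l2 (F *ᵥ x) ≤ (∑' j, b j) * l2 x := by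
  refine l2_mulVec_le_of_sums (tsum_nonneg hb0) (fun p => ?_) (fun q => ?_) x
  · calc _ ≤ ∑ q, b (f p - g q) := Finset.sum_le_sum fun q _ => hF p q
      _ = ∑' q, b (f p - g q) := (tsum_fintype _).symm
      _ ≤ _ := tsum_comp_le_tsum_of_inj hb hb0 (i := fun q => f p - g q)
          (fun q q' h => hg (by simpa using h))
  · calc _ ≤ ∑ p, b (f p - g q) := Finset.sum_le_sum fun p _ => hF p q
      _ = ∑' p, b (f p - g q) := (tsum_fintype _).symm
      _ ≤ _ := tsum_comp_le_tsum_of_inj hb hb0 (i := fun p => f p - g q)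
          (fun q q' h => hf (by simpa using h))

variable [DecidableEq κ]

lemma sval_le (F : Matrix ι κ ℂ) {x : κ → ℂ} (hx : x ≠ 0) {c : ℝ}
    (h : l2 (F *ᵥ x) ≤ c * l2 x) : sval F ≤ c := by
  have hpos := l2_pos hx
  set u : EuclideanSpace ℂ κ := WithLp.toLp 2 x with hu
  have hun : ‖u‖ = l2 x := rfl
  have hle : sval F ≤ ‖Matrix.toEuclideanLin F (((l2 x : ℂ)⁻¹) • u)‖ := by
    refine csInf_le ⟨0, ?_⟩ ⟨((l2 x : ℂ)⁻¹) • u, ?_, rfl⟩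
    · rintro y ⟨v, -, rfl⟩
      exact norm_nonneg _
    · rw [norm_smul, hun, norm_inv, Complex.norm_real, Real.norm_of_nonneg hpos.le,
        inv_mul_cancel₀ hpos.ne']
  refine hle.trans ?_
  have hF : ‖Matrix.toEuclideanLin F u‖ = l2 (F *ᵥ x) := rfl
  rw [map_smul, norm_smul, hF, norm_inv, Complex.norm_real, Real.norm_of_nonneg hpos.le,
    inv_mul_le_iff₀ hpos]
  linarith

lemma exists_of_sval_lt [Nonempty κ] {F : Matrix ι κ ℂ} {c : ℝ} (h : sval F < c) :
    ∃ x : κ → ℂ, x ≠ 0 ∧ l2 (F *ᵥ x) < c * l2 x := by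
  obtain ⟨i⟩ := ‹Nonempty κ›
  obtain ⟨y, ⟨x, hx, rfl⟩, hy⟩ := exists_lt_of_csInf_lt
    (s := {y : ℝ | ∃ x : EuclideanSpace ℂ κ, ‖x‖ = 1 ∧ y = ‖Matrix.toEuclideanLin F x‖})
    ⟨_, EuclideanSpace.single i (1 : ℂ), by simp, rfl⟩ h
  have hx' : l2 (x.ofLp) = 1 := hx
  refine ⟨x.ofLp, ne_zero_of_l2_pos (by rw [hx']; exact one_pos), ?_⟩
  rw [hx', mul_one]
  exact hy

lemma l2_mulVec_le_of_le_one {F : Matrix ι κ ℂ} {c : ℝ}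
    (h : ∀ x : EuclideanSpace ℂ κ, ‖x‖ = 1 → ‖Matrix.toEuclideanLin F x‖ ≤ c) (x : κ → ℂ) :
    l2 (F *ᵥ x) ≤ c * l2 x := by
  by_cases hx : x = 0
  · subst hx; rw [mulVec_zero, l2_zero, l2_zero, mul_zero]
  have hpos := l2_pos hx
  set u : EuclideanSpace ℂ κ := WithLp.toLp 2 x with hu
  have hun : ‖u‖ = l2 x := rfl
  have h1 := h (((l2 x : ℂ)⁻¹) • u) (by
    rw [norm_smul, hun, norm_inv, Complex.norm_real, Real.norm_of_nonneg hpos.le,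
        inv_mul_cancel₀ hpos.ne'])
  have hF : ‖Matrix.toEuclideanLin F u‖ = l2 (F *ᵥ x) := rfl
  rw [map_smul, norm_smul, hF, norm_inv, Complex.norm_real, Real.norm_of_nonneg hpos.le,
    inv_mul_le_iff₀ hpos] at h1
  linarith

lemma l2_mulVec_le_opNorm (F : Matrix ι κ ℂ) (x : κ → ℂ) :
    l2 (F *ᵥ x) ≤ opNorm F * l2 x := by
  refine l2_mulVec_le_of_le_one (fun u hu => ?_) x
  refine le_csSup ⟨‖LinearMap.toContinuousLinearMap (Matrix.toEuclideanLin F)‖, ?_⟩ ⟨u, hu, rfl⟩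
  rintro y ⟨v, hv, rfl⟩
  have := (LinearMap.toContinuousLinearMap (Matrix.toEuclideanLin F)).le_opNorm v
  rwa [hv, mul_one] at this

lemma opNorm_nonneg (F : Matrix ι κ ℂ) : 0 ≤ opNorm F := by
  refine Real.sSup_nonneg ?_
  rintro y ⟨v, -, rfl⟩
  exact norm_nonneg _

lemma opNorm_le {F : Matrix ι κ ℂ} {c : ℝ} (hc : 0 ≤ c)
    (h : ∀ x, l2 (F *ᵥ x) ≤ c * l2 x) : opNorm F ≤ c := by
  refine Real.sSup_le ?_ hc
  rintro y ⟨v, hv, rfl⟩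
  have h1 := h v.ofLp
  have hv' : l2 v.ofLp = 1 := hv
  rw [hv', mul_one] at h1
  exact h1

end Finite

section Tail

/-- The part of the Wiener norm carried by the coefficients of index at least `w` in modulus. -/
def wTail (a : ℤ → ℂ) (w : ℕ) (j : ℤ) : ℝ := if (w : ℤ) ≤ |j| then ‖a j‖ else 0

lemma wTail_nonneg (a : ℤ → ℂ) (w : ℕ) (j : ℤ) : 0 ≤ wTail a w j := by
  unfold wTail; split_ifs <;> simp

lemma wTail_le (a : ℤ → ℂ) (w : ℕ) (j : ℤ) : wTail a w j ≤ ‖a j‖ := by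
  unfold wTail; split_ifs <;> simp

lemma summable_wTail {a : ℤ → ℂ} (ha : Summable fun j => ‖a j‖) (w : ℕ) :
    Summable (wTail a w) :=
  Summable.of_nonneg_of_le (wTail_nonneg a w) (wTail_le a w) ha

lemma tendsto_tsum_wTail {a : ℤ → ℂ} (ha : Summable fun j => ‖a j‖) :
    Filter.Tendsto (fun w : ℕ => ∑' j, wTail a w j) Filter.atTop (nhds 0) := by
  have := tendsto_tsum_of_dominated_convergence (𝓕 := Filter.atTop)
    (f := fun w : ℕ => wTail a w) (g := fun _ => (0 : ℝ)) ha (fun j => ?_)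
    (Filter.Eventually.of_forall fun w j => ?_)
  · simpa using this
  · refine tendsto_const_nhds.congr' ?_
    filter_upwards [Filter.eventually_gt_atTop j.natAbs] with w hw
    unfold wTail
    rw [if_neg]
    rw [Int.abs_eq_natAbs]
    omega
  · rw [Real.norm_of_nonneg (wTail_nonneg a w j)]
    exact wTail_le a w j

end Tail

end SpecIncl

namespace SpecIncl

section Localization

lemma sin_pi_div_nonneg (n : ℕ) : 0 ≤ Real.sin (π / (2 * n + 2)) := by
  apply Real.sin_nonneg_of_nonneg_of_le_pi
  · have := Real.pi_pos
    positivity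
  · rw [div_le_iff₀ (by positivity)]
    nlinarith [Real.pi_pos, Nat.cast_nonneg (α := ℝ) n]

/-- The sine window supported on `{1, …, n}`. -/
def sineWindow (n : ℕ) (j : ℤ) : ℝ :=
  if 0 ≤ j ∧ j ≤ (n : ℤ) + 1 then Real.sin (j * (π / (n + 1))) else 0

lemma sineWindow_natCast {n j : ℕ} (hj : j ≤ n + 1) :
    sineWindow n j = Real.sin (j * (π / (n + 1))) := by
  unfold sineWindow
  rw [if_pos ⟨by omega, by omega⟩]
  simp

lemma sineWindow_eq_zero {n : ℕ} {j : ℤ} (h : j ≤ 0 ∨ (n : ℤ) + 1 ≤ j) : sineWindow n j = 0 := by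
  unfold sineWindow
  split_ifs with hj
  · have hn : (n : ℝ) + 1 ≠ 0 := by positivity
    rcases h with h | h
    · have : j = 0 := by omega
      simp [this]
    · have : j = (n : ℤ) + 1 := by omega
      rw [this]
      push_cast
      rw [mul_div_cancel₀ _ hn, Real.sin_pi]
  · rfl

lemma sum_sin_diff_sq (θ : ℝ) (K : ℕ) :
    ∑ j ∈ Finset.range K, (Real.sin (j * θ) - Real.sin ((j + 1) * θ)) ^ 2
      = 4 * Real.sin (θ / 2) ^ 2 * ∑ j ∈ Finset.range K, Real.sin (j * θ) ^ 2
        + Real.sin (K * θ) * (Real.sin (K * θ) - Real.sin ((K - 1) * θ)) := by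
  induction K with
  | zero => simp
  | succ K ih =>
    rw [Finset.sum_range_succ, Finset.sum_range_succ, ih]
    have h1 : Real.sin ((K + 1) * θ)
        = Real.sin (K * θ) * Real.cos θ + Real.cos (K * θ) * Real.sin θ := by
      rw [add_mul, one_mul, Real.sin_add]
    have h2 : Real.sin (((K : ℝ) - 1) * θ)
        = Real.sin (K * θ) * Real.cos θ - Real.cos (K * θ) * Real.sin θ := by
      rw [sub_mul, one_mul, Real.sin_sub]
    have h3 : 4 * Real.sin (θ / 2) ^ 2 = 2 * (1 - Real.cos θ) := by
      rw [Real.sin_sq_eq_half_sub]; ring_nf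
    have h4 : (((K + 1 : ℕ) : ℝ) - 1) * θ = K * θ := by push_cast; ring
    rw [h4, h3]
    push_cast
    rw [h1, h2]
    ring

lemma sum_sineWindow_diff_sq (n : ℕ) :
    ∑ j ∈ Finset.range (n + 1), (sineWindow n j - sineWindow n ((j : ℤ) + 1)) ^ 2
      = (2 * Real.sin (π / (2 * n + 2))) ^ 2 *
        ∑ j ∈ Finset.range (n + 1), sineWindow n j ^ 2 := by
  have hn : (n : ℝ) + 1 ≠ 0 := by positivity
  have h := sum_sin_diff_sq (π / (n + 1)) (n + 1)
  have h0 : Real.sin (((n + 1 : ℕ) : ℝ) * (π / (n + 1))) = 0 := by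
    push_cast
    rw [mul_div_cancel₀ _ hn, Real.sin_pi]
  have hhalf : π / ((n : ℝ) + 1) / 2 = π / (2 * n + 2) := by
    rw [div_div]; ring_nf
  rw [h0, zero_mul, add_zero, hhalf] at h
  calc _ = ∑ j ∈ Finset.range (n + 1),
        (Real.sin (j * (π / (n + 1))) - Real.sin ((j + 1) * (π / (n + 1)))) ^ 2 := by
        refine Finset.sum_congr rfl fun j hj => ?_
        have hj := Finset.mem_range.1 hj
        have e : ((j : ℤ) + 1) = ((j + 1 : ℕ) : ℤ) := by push_cast; ring
        rw [e, sineWindow_natCast (by omega), sineWindow_natCast (by omega)]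
        push_cast
        rfl
    _ = _ := h
    _ = _ := by
        rw [mul_pow]
        congr 1
        · norm_num
        · refine Finset.sum_congr rfl fun j hj => ?_
          have hj := Finset.mem_range.1 hj
          rw [sineWindow_natCast (by omega)]

lemma sum_sineWindow_sq_pos {n : ℕ} (hn : 1 ≤ n) :
    0 < ∑ j ∈ Finset.range (n + 1), sineWindow n j ^ 2 := by
  refine Finset.sum_pos' (fun _ _ => sq_nonneg _) ⟨1, Finset.mem_range.2 (by omega), ?_⟩
  have hn' : (1 : ℝ) ≤ n := by exact_mod_cast hn
  rw [sineWindow_natCast (by omega)]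
  have : 0 < Real.sin (((1 : ℕ) : ℝ) * (π / (n + 1))) := by
    apply Real.sin_pos_of_pos_of_lt_pi
    · have := Real.pi_pos
      push_cast
      positivity
    · push_cast
      rw [one_mul, div_lt_iff₀ (by positivity)]
      nlinarith [Real.pi_pos]
  positivity

lemma sum_shift {n R : ℕ} {f : ℤ → ℝ} (hf : ∀ j, (j < 0 ∨ (n : ℤ) < j) → f j = 0) {β : ℤ}
    (hβ : |β| + n ≤ R) :
    ∑ k ∈ Finset.Icc (-(R : ℤ)) R, f (β - k) = ∑ j ∈ Finset.range (n + 1), f j := by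
  symm
  have h1 := le_abs_self β
  have h2 := neg_abs_le β
  refine Finset.sum_of_injOn (fun j : ℕ => β - j) (fun i _ j _ h => by simpa using h) ?_ ?_ ?_
  · intro j hj
    have hj := Finset.mem_range.1 (Finset.mem_coe.1 hj)
    rw [Finset.mem_coe, Finset.mem_Icc]
    constructor <;> dsimp only <;> omega
  · intro k _ hk
    apply hf
    by_contra hcon
    push Not at hcon
    refine hk ⟨(β - k).toNat, ?_, ?_⟩
    · rw [Finset.mem_coe, Finset.mem_range]; omega
    · simp only; omega
  · intro j _
    simp

lemma sum_add_sq_le {K : Type*} {s : Finset K} {f g : K → ℝ} {A B : ℝ} (hA : 0 ≤ A) (hB : 0 ≤ B)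
    (hf : ∑ k ∈ s, f k ^ 2 ≤ A ^ 2) (hg : ∑ k ∈ s, g k ^ 2 ≤ B ^ 2) :
    ∑ k ∈ s, (f k + g k) ^ 2 ≤ (A + B) ^ 2 := by
  have h1 : ∑ k ∈ s, f k * g k ≤ A * B := by
    apply le_of_sq_le_sq _ (by positivity)
    calc _ ≤ (∑ k ∈ s, f k ^ 2) * ∑ k ∈ s, g k ^ 2 := Finset.sum_mul_sq_le_sq_mul_sq _ _ _
      _ ≤ A ^ 2 * B ^ 2 := by gcongr
      _ = _ := by ring
  calc _ = ∑ k ∈ s, f k ^ 2 + 2 * ∑ k ∈ s, f k * g k + ∑ k ∈ s, g k ^ 2 := by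
        rw [Finset.mul_sum, ← Finset.sum_add_distrib, ← Finset.sum_add_distrib]
        exact Finset.sum_congr rfl fun k _ => by ring
    _ ≤ _ := by nlinarith

open Matrix

variable {ι : Type*} [Fintype ι]

lemma sum_l2_sq_weight {s : Finset ℤ} {g : ℤ → ι → ℝ} {S : ℝ} (hg : ∀ p, ∑ k ∈ s, g k p ^ 2 = S)
    (x : ι → ℂ) : ∑ k ∈ s, l2 (fun p => (g k p : ℂ) * x p) ^ 2 = S * l2 x ^ 2 := by
  simp_rw [l2_sq]
  rw [Finset.sum_comm, Finset.mul_sum]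
  refine Finset.sum_congr rfl fun p _ => ?_
  rw [← hg p, Finset.sum_mul]
  refine Finset.sum_congr rfl fun k _ => ?_
  rw [norm_mul, mul_pow, Complex.norm_real, Real.norm_eq_abs, sq_abs]

/-- An approximate null vector of a block tridiagonal matrix can be localized to a window of `n`
consecutive blocks. -/
lemma exists_localized (β : ι → ℤ) (B L U : Matrix ι ι ℂ)
    (hL : ∀ p q, L p q = if β p = β q + 1 then B p q else 0)
    (hU : ∀ p q, U p q = if β p = β q - 1 then B p q else 0)
    (hB : ∀ p q, 1 < |β p - β q| → B p q = 0) {rl ru : ℝ} (hrl : 0 ≤ rl) (hru : 0 ≤ ru)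
    (hLn : ∀ x, l2 (L *ᵥ x) ≤ rl * l2 x) (hUn : ∀ x, l2 (U *ᵥ x) ≤ ru * l2 x)
    {n : ℕ} (hn : 1 ≤ n) {x : ι → ℂ} (hx : x ≠ 0) {ρ : ℝ} (hρ : 0 ≤ ρ)
    (h : l2 (B *ᵥ x) ≤ ρ * l2 x) :
    ∃ (k : ℤ) (y : ι → ℂ), y ≠ 0 ∧ (∀ p, y p ≠ 0 → k < β p ∧ β p ≤ k + n) ∧
      l2 (B *ᵥ y) ≤ (ρ + 2 * (rl + ru) * Real.sin (π / (2 * n + 2))) * l2 y := by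
  classical
  set φ := sineWindow n with hφ
  set σ := Real.sin (π / (2 * n + 2)) with hσ
  set S := ∑ j ∈ Finset.range (n + 1), φ j ^ 2 with hS
  have hS0 : 0 < S := sum_sineWindow_sq_pos hn
  have hσ0 : 0 ≤ σ := sin_pi_div_nonneg n
  obtain ⟨R, hR⟩ : ∃ R : ℕ, ∀ p, |β p| + 1 + n ≤ R := by
    refine ⟨(∑ p, (β p).natAbs) + 1 + n, fun p => ?_⟩
    have := Finset.single_le_sum (f := fun p => (β p).natAbs) (fun _ _ => Nat.zero_le _)
      (Finset.mem_univ p)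
    rw [Int.abs_eq_natAbs]
    exact_mod_cast (by omega : (β p).natAbs + 1 + n ≤ (∑ p, (β p).natAbs) + 1 + n)
  set s := Finset.Icc (-(R : ℤ)) R with hs
  have hφ2 : ∀ j : ℤ, (j < 0 ∨ (n : ℤ) < j) → φ j ^ 2 = 0 := fun j hj => by
    rw [hφ, sineWindow_eq_zero (by omega)]; norm_num
  have hd2 : ∀ j : ℤ, (j < 0 ∨ (n : ℤ) < j) → (φ j - φ (j + 1)) ^ 2 = 0 := fun j hj => by
    rw [hφ, sineWindow_eq_zero (by omega), sineWindow_eq_zero (by omega)]; norm_num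
  have hw : ∀ p, ∑ k ∈ s, φ (β p - k) ^ 2 = S := fun p =>
    sum_shift (f := fun j => φ j ^ 2) hφ2 (by have := hR p; omega)
  have hwl : ∀ p, ∑ k ∈ s, (φ (β p - k) - φ (β p - k + 1)) ^ 2 = (2 * σ) ^ 2 * S := fun p => by
    rw [hS, ← sum_sineWindow_diff_sq]
    exact sum_shift (f := fun j => (φ j - φ (j + 1)) ^ 2) hd2 (by have := hR p; omega)
  have hwu : ∀ p, ∑ k ∈ s, (φ (β p - k) - φ (β p - k - 1)) ^ 2 = (2 * σ) ^ 2 * S := fun p => by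
    rw [hS, ← sum_sineWindow_diff_sq]
    have h1 := sum_shift (f := fun j => (φ j - φ (j + 1)) ^ 2) hd2 (R := R) (β := β p - 1) (by
      have := hR p
      have h2 := abs_sub (β p) 1
      rw [abs_one] at h2
      omega)
    rw [← h1]
    refine Finset.sum_congr rfl fun k _ => ?_
    have e1 : β p - 1 - k = β p - k - 1 := by ring
    have e2 : β p - k - 1 + 1 = β p - k := by ring
    rw [e1, e2]
    ring
  set y : ℤ → ι → ℂ := fun k p => (φ (β p - k) : ℂ) * x p with hy
  set vl : ℤ → ι → ℂ := fun k p => ((φ (β p - k) - φ (β p - k + 1) : ℝ) : ℂ) * x p with hvl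
  set vu : ℤ → ι → ℂ := fun k p => ((φ (β p - k) - φ (β p - k - 1) : ℝ) : ℂ) * x p with hvu
  set u : ℤ → ι → ℂ := fun k p => (φ (β p - k) : ℂ) * (B *ᵥ x) p with hu
  have hcomm : ∀ k, B *ᵥ y k = u k + L *ᵥ vl k + U *ᵥ vu k := by
    intro k
    funext p
    simp only [hu, hvl, hvu, hy, Pi.add_apply, mulVec, dotProduct, Finset.mul_sum,
      ← Finset.sum_add_distrib]
    refine Finset.sum_congr rfl fun q _ => ?_
    rw [hL, hU]
    by_cases h1 : β p = β q + 1
    · have h2 : ¬ β p = β q - 1 := by omega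
      rw [if_pos h1, if_neg h2]
      have e : β p - k = β q - k + 1 := by omega
      rw [e]
      push_cast
      ring
    · by_cases h2 : β p = β q - 1
      · rw [if_neg h1, if_pos h2]
        have e : β p - k = β q - k - 1 := by omega
        rw [e]
        push_cast
        ring
      · rw [if_neg h1, if_neg h2]
        by_cases h3 : β p = β q
        · rw [h3]; ring
        · rw [hB p q (by rw [lt_abs]; omega)]
          ring
  set X := l2 x with hX
  have hX0 : 0 < X := l2_pos hx
  have sy : ∑ k ∈ s, l2 (y k) ^ 2 = S * X ^ 2 :=
    sum_l2_sq_weight (g := fun k p => φ (β p - k)) hw x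
  have su : ∑ k ∈ s, l2 (u k) ^ 2 ≤ (√S * (ρ * X)) ^ 2 := by
    rw [sum_l2_sq_weight (g := fun k p => φ (β p - k)) hw, mul_pow, Real.sq_sqrt hS0.le]
    have := l2_nonneg (B *ᵥ x)
    gcongr
  have sl : ∑ k ∈ s, (rl * l2 (vl k)) ^ 2 ≤ (√S * (rl * (2 * σ) * X)) ^ 2 := by
    simp_rw [mul_pow, ← Finset.mul_sum]
    rw [sum_l2_sq_weight (g := fun k p => φ (β p - k) - φ (β p - k + 1)) hwl,
      Real.sq_sqrt hS0.le]
    apply le_of_eq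
    ring
  have sU : ∑ k ∈ s, (ru * l2 (vu k)) ^ 2 ≤ (√S * (ru * (2 * σ) * X)) ^ 2 := by
    simp_rw [mul_pow, ← Finset.mul_sum]
    rw [sum_l2_sq_weight (g := fun k p => φ (β p - k) - φ (β p - k - 1)) hwu,
      Real.sq_sqrt hS0.le]
    apply le_of_eq
    ring
  set c := ρ + 2 * (rl + ru) * σ with hc
  have stot := sum_add_sq_le (by positivity) (by positivity)
    (sum_add_sq_le (by positivity) (by positivity) su sl) sU
  have htot : ∑ k ∈ s, l2 (B *ᵥ y k) ^ 2 ≤ ∑ k ∈ s, (c * l2 (y k)) ^ 2 := by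
    simp_rw [mul_pow, ← Finset.mul_sum]
    rw [sy]
    calc _ ≤ ∑ k ∈ s, (l2 (u k) + rl * l2 (vl k) + ru * l2 (vu k)) ^ 2 := by
          refine Finset.sum_le_sum fun k _ => ?_
          have h0 := l2_nonneg (B *ᵥ y k)
          have h1 : l2 (B *ᵥ y k) ≤ l2 (u k) + rl * l2 (vl k) + ru * l2 (vu k) := by
            rw [hcomm]
            calc _ ≤ _ := l2_add_le _ _
              _ ≤ l2 (u k) + l2 (L *ᵥ vl k) + l2 (U *ᵥ vu k) := by
                gcongr
                exact l2_add_le _ _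
              _ ≤ _ := by
                gcongr
                · exact hLn _
                · exact hUn _
          gcongr
      _ ≤ _ := stot
      _ = √S ^ 2 * (c * X) ^ 2 := by rw [hc]; ring
      _ = _ := by rw [Real.sq_sqrt hS0.le]; ring
  have hc0 : 0 ≤ c := by positivity
  obtain ⟨k, -, hk0, hk⟩ : ∃ k ∈ s, y k ≠ 0 ∧ l2 (B *ᵥ y k) ^ 2 ≤ (c * l2 (y k)) ^ 2 := by
    by_contra! hcon
    have hle : ∀ k ∈ s, (c * l2 (y k)) ^ 2 ≤ l2 (B *ᵥ y k) ^ 2 := by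
      intro k hk
      by_cases h0 : y k = 0
      · simp [h0, l2_zero]
      · exact (hcon k hk h0).le
    obtain ⟨k, hk, hkne⟩ : ∃ k ∈ s, y k ≠ 0 := by
      by_contra! hz
      have : ∑ k ∈ s, l2 (y k) ^ 2 = 0 := Finset.sum_eq_zero fun k hk => by
        rw [hz k hk, l2_zero]; norm_num
      rw [sy] at this
      have : 0 < S * X ^ 2 := by positivity
      linarith
    exact absurd htot (not_le.2 (Finset.sum_lt_sum hle ⟨k, hk, hcon k hk hkne⟩))
  refine ⟨k, y k, hk0, fun p hp => ?_, le_of_sq_le_sq hk (mul_nonneg hc0 (l2_nonneg _))⟩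
  by_contra hcon
  apply hp
  have : φ (β p - k) = 0 := sineWindow_eq_zero (by omega)
  simp [hy, this]

end Localization

end SpecIncl

namespace SpecIncl

section Sequences

/-- The Hilbert space of square-summable complex sequences. -/
abbrev SeqSpace : Type := lp (fun _ : ℕ => ℂ) 2

/-- Some finitely supported sequence is contracted by a factor less than `c` by the Toeplitz
operator with coefficients `b`, shifted by `z`. -/
def SeqShrinks (b : ℤ → ℂ) (c : ℝ) (z : ℂ) : Prop :=
  ∃ (L : ℕ) (x : ℕ → ℂ) (d : ℝ), (∀ j, L ≤ j → x j = 0) ∧ 0 ≤ d ∧ d < c ∧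
    0 < ∑ j ∈ Finset.range L, ‖x j‖ ^ 2 ∧
    ∀ M, ∑ i ∈ Finset.range M,
      ‖∑ j ∈ Finset.range L, b ((i : ℤ) - j) * x j - z * x i‖ ^ 2
        ≤ d ^ 2 * ∑ j ∈ Finset.range L, ‖x j‖ ^ 2

/-- The truncation of a sequence to its first `L` entries. -/
def trunc (x : ℕ → ℂ) (L : ℕ) : SeqSpace := ∑ j ∈ Finset.range L, lp.single 2 j (x j)

lemma trunc_apply (x : ℕ → ℂ) (L i : ℕ) :
    (trunc x L : ℕ → ℂ) i = if i < L then x i else 0 := by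
  unfold trunc
  rw [lp.coeFn_sum, Finset.sum_apply]
  simp [lp.single_apply, Pi.single_apply]

lemma norm_trunc_sq (x : ℕ → ℂ) (L : ℕ) :
    ‖trunc x L‖ ^ 2 = ∑ j ∈ Finset.range L, ‖x j‖ ^ 2 := by
  have := lp.norm_sum_single (p := 2) (E := fun _ : ℕ => ℂ) (by norm_num) x (Finset.range L)
  simpa [trunc] using this

lemma sub_smul_trunc_apply {S : SeqSpace →L[ℂ] SeqSpace} {b : ℤ → ℂ}
    (hS : ∀ i j : ℕ, (S (lp.single 2 j (1 : ℂ)) : ℕ → ℂ) i = b ((i : ℤ) - j)) (z : ℂ)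
    (x : ℕ → ℂ) (L i : ℕ) :
    ((S - z • (1 : SeqSpace →L[ℂ] SeqSpace)) (trunc x L) : ℕ → ℂ) i
      = ∑ j ∈ Finset.range L, b ((i : ℤ) - j) * x j - z * if i < L then x i else 0 := by
  have h1 : S (trunc x L) = ∑ j ∈ Finset.range L, x j • S (lp.single 2 j (1 : ℂ)) := by
    unfold trunc
    rw [map_sum]
    refine Finset.sum_congr rfl fun j _ => ?_
    rw [← map_smul, ← lp.single_smul, smul_eq_mul, mul_one]
  rw [sub_apply, smul_apply, one_apply_eq_self, lp.coeFn_sub, Pi.sub_apply, lp.coeFn_smul,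
    Pi.smul_apply, trunc_apply, h1, lp.coeFn_sum, Finset.sum_apply]
  congr 1
  refine Finset.sum_congr rfl fun j _ => ?_
  rw [lp.coeFn_smul, Pi.smul_apply, hS, smul_eq_mul, mul_comm]

lemma sum_sq_le_norm_sq (f : SeqSpace) (s : Finset ℕ) :
    ∑ i ∈ s, ‖(f : ℕ → ℂ) i‖ ^ 2 ≤ ‖f‖ ^ 2 := by
  have := lp.sum_rpow_le_norm_rpow (p := 2) (by norm_num) f s
  simpa using this

lemma norm_le_of_sum_sq_le {f : SeqSpace} {C : ℝ} (hC : 0 ≤ C)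
    (h : ∀ M, ∑ i ∈ Finset.range M, ‖(f : ℕ → ℂ) i‖ ^ 2 ≤ C ^ 2) : ‖f‖ ≤ C := by
  refine lp.norm_le_of_forall_sum_le (p := 2) (by norm_num) hC (fun s => ?_)
  obtain ⟨M, hM⟩ := s.exists_nat_subset_range
  have h1 : ∑ i ∈ s, ‖(f : ℕ → ℂ) i‖ ^ 2 ≤ C ^ 2 :=
    (Finset.sum_le_sum_of_subset_of_nonneg hM fun _ _ _ => by positivity).trans (h M)
  simpa using h1

lemma exists_norm_lt_iff_seqShrinks {S : SeqSpace →L[ℂ] SeqSpace} {b : ℤ → ℂ}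
    (hS : ∀ i j : ℕ, (S (lp.single 2 j (1 : ℂ)) : ℕ → ℂ) i = b ((i : ℤ) - j)) (z : ℂ) (c : ℝ) :
    (∃ x, ‖(S - z • (1 : SeqSpace →L[ℂ] SeqSpace)) x‖ < c * ‖x‖) ↔ SeqShrinks b c z := by
  constructor
  · rintro ⟨x, hx⟩
    have hlim : Filter.Tendsto (fun L => trunc x L) Filter.atTop (nhds x) :=
      (lp.hasSum_single (p := 2) (by norm_num) x).tendsto_sum_nat
    have hlim1 : Filter.Tendsto (fun L => c * ‖trunc x L‖ -
        ‖(S - z • (1 : SeqSpace →L[ℂ] SeqSpace)) (trunc x L)‖) Filter.atTop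
        (nhds (c * ‖x‖ - ‖(S - z • (1 : SeqSpace →L[ℂ] SeqSpace)) x‖)) :=
      (hlim.norm.const_mul c).sub
        (((S - z • (1 : SeqSpace →L[ℂ] SeqSpace)).continuous.tendsto x).comp hlim).norm
    obtain ⟨L, hL⟩ := (hlim1.eventually (lt_mem_nhds (sub_pos.2 hx))).exists
    have hL := sub_pos.1 hL
    have ht0 : 0 < ‖trunc x L‖ := by
      rw [norm_pos_iff]; intro h0; rw [h0] at hL; simp at hL
    have hcongr : ∑ j ∈ Finset.range L, ‖if j < L then (x : ℕ → ℂ) j else 0‖ ^ 2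
        = ‖trunc x L‖ ^ 2 := by
      rw [norm_trunc_sq]
      refine Finset.sum_congr rfl fun j hj => ?_
      rw [if_pos (Finset.mem_range.1 hj)]
    refine ⟨L, fun j => if j < L then (x : ℕ → ℂ) j else 0,
      ‖(S - z • (1 : SeqSpace →L[ℂ] SeqSpace)) (trunc x L)‖ / ‖trunc x L‖,
      fun j hj => if_neg (not_lt.2 hj), by positivity, ?_, ?_, fun M => ?_⟩
    · rwa [div_lt_iff₀ ht0]
    · rw [hcongr]; positivity
    · rw [hcongr, div_pow, div_mul_cancel₀ _ (by positivity)]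
      refine le_trans (le_of_eq ?_) (sum_sq_le_norm_sq _ (Finset.range M))
      refine Finset.sum_congr rfl fun i _ => ?_
      rw [sub_smul_trunc_apply hS]
      congr 3
      refine Finset.sum_congr rfl fun j hj => ?_
      simp only [if_pos (Finset.mem_range.1 hj)]
  · rintro ⟨L, x, d, hx0, hd0, hd, hpos, hM⟩
    refine ⟨trunc x L, ?_⟩
    rw [← norm_trunc_sq] at hpos
    have ht0 : 0 < ‖trunc x L‖ := by
      rw [norm_pos_iff]; intro h0; rw [h0] at hpos; simp at hpos
    refine lt_of_le_of_lt (norm_le_of_sum_sq_le (C := d * ‖trunc x L‖) (by positivity) fun M => ?_)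
      (by gcongr)
    refine le_trans (le_of_eq ?_) ((hM M).trans_eq ?_)
    · refine Finset.sum_congr rfl fun i _ => ?_
      rw [sub_smul_trunc_apply hS]
      split_ifs with hi
      · rfl
      · rw [hx0 i (not_lt.1 hi)]
    · rw [mul_pow, norm_trunc_sq]

lemma seqShrinks_conj {b : ℤ → ℂ} {c : ℝ} {z : ℂ} (h : SeqShrinks b c z) :
    SeqShrinks (fun j => star (b j)) c (star z) := by
  obtain ⟨L, x, d, hx0, hd0, hd, hpos, hM⟩ := h
  refine ⟨L, fun j => star (x j), d, fun j hj => by simp [hx0 j hj], hd0, hd, ?_, fun M => ?_⟩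
  · simpa only [norm_star] using hpos
  · simp only [norm_star]
    refine le_trans (le_of_eq ?_) (hM M)
    refine Finset.sum_congr rfl fun i _ => ?_
    rw [← norm_star]
    simp [star_sum]

lemma shrinks_iff_seqShrinks {a : ℤ → ℂ} {T : SeqSpace →L[ℂ] SeqSpace}
    (hT : ∀ (x : SeqSpace) (i : ℕ),
      (T x : ℕ → ℂ) i = ∑' j : ℕ, a ((i : ℤ) - (j : ℤ)) * (x : ℕ → ℂ) j)
    (c : ℝ) (z : ℂ) :
    Shrinks T c z ↔ SeqShrinks a c z ∨ SeqShrinks (fun j => a (-j)) c z := by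
  have hS : ∀ i j : ℕ, (T (lp.single 2 j (1 : ℂ)) : ℕ → ℂ) i = a ((i : ℤ) - j) := by
    intro i j
    rw [hT, tsum_eq_single j]
    · simp
    · intro k hk
      rw [lp.single_apply_ne _ _ _ hk, mul_zero]
  have hS' : ∀ i j : ℕ, ((star T) (lp.single 2 j (1 : ℂ)) : ℕ → ℂ) i
      = star (a (-((i : ℤ) - j))) := by
    intro i j
    have h1 := lp.inner_single_left (𝕜 := ℂ) (G := fun _ : ℕ => ℂ) i (1 : ℂ)
      ((star T) (lp.single 2 j (1 : ℂ)))
    have h2 := ContinuousLinearMap.adjoint_inner_right T (lp.single 2 i (1 : ℂ))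
      (lp.single 2 j (1 : ℂ))
    have h3 := lp.inner_single_right (𝕜 := ℂ) (G := fun _ : ℕ => ℂ) j (1 : ℂ)
      (T (lp.single 2 i (1 : ℂ)))
    rw [ContinuousLinearMap.star_eq_adjoint] at h1 ⊢
    rw [h2, h3, hS] at h1
    simpa using h1.symm
  have hstar : star (T - z • (1 : SeqSpace →L[ℂ] SeqSpace)) =
      star T - star z • (1 : SeqSpace →L[ℂ] SeqSpace) := by
    simp
  unfold Shrinks
  rw [hstar, exists_norm_lt_iff_seqShrinks hS,
    exists_norm_lt_iff_seqShrinks (b := fun j => star (a (-j))) hS']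
  refine or_congr Iff.rfl ⟨fun h => ?_, fun h => seqShrinks_conj h⟩
  have := seqShrinks_conj h
  simpa only [star_star] using this

end Sequences

end SpecIncl

namespace SpecIncl

section FiniteToeplitz

open Matrix

/-- Some nonzero vector is contracted by a factor at most `c` by the order-`M` Toeplitz matrix
with coefficients `a`, shifted by `z`. -/
def ToepShrinks (a : ℤ → ℂ) (M : ℕ) (c : ℝ) (z : ℂ) : Prop :=
  ∃ x : Fin M → ℂ, x ≠ 0 ∧ l2 ((ToepM a M - z • (1 : Matrix (Fin M) (Fin M) ℂ)) *ᵥ x) ≤ c * l2 x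

lemma toepM_sub_smul_mulVec (a : ℤ → ℂ) (M : ℕ) (z : ℂ) (x : Fin M → ℂ) (i : Fin M) :
    ((ToepM a M - z • (1 : Matrix (Fin M) (Fin M) ℂ)) *ᵥ x) i
      = ∑ j : Fin M, a ((i : ℤ) - j) * x j - z * x i := by
  rw [sub_mulVec, smul_mulVec, one_mulVec]
  rfl

lemma toepM_flip_mulVec (a : ℤ → ℂ) (M : ℕ) (z : ℂ) (x : Fin M → ℂ) :
    (ToepM a M - z • (1 : Matrix (Fin M) (Fin M) ℂ)) *ᵥ (x ∘ Fin.rev)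
      = ((ToepM (fun j => a (-j)) M - z • (1 : Matrix (Fin M) (Fin M) ℂ)) *ᵥ x) ∘ Fin.rev := by
  ext i
  rw [Function.comp_apply, toepM_sub_smul_mulVec, toepM_sub_smul_mulVec]
  congr 1
  refine Fintype.sum_equiv Fin.revPerm _ _ fun j => ?_
  simp

lemma l2_comp_rev {M : ℕ} (x : Fin M → ℂ) : l2 (x ∘ Fin.rev) = l2 x :=
  l2_comp Fin.rev_injective fun p hp => absurd (Fin.rev_surjective p) hp

lemma toepShrinks_of_flip {a : ℤ → ℂ} {M : ℕ} {c : ℝ} {z : ℂ}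
    (h : ToepShrinks (fun j => a (-j)) M c z) : ToepShrinks a M c z := by
  obtain ⟨x, hx, h⟩ := h
  refine ⟨x ∘ Fin.rev, ne_zero_of_l2_pos ?_, ?_⟩
  · rw [l2_comp_rev]; exact l2_pos hx
  · rwa [toepM_flip_mulVec, l2_comp_rev, l2_comp_rev]

lemma exists_toepShrinks_of_seqShrinks {a : ℤ → ℂ} {c : ℝ} {z : ℂ} (h : SeqShrinks a c z) :
    ∃ L, ∀ M, L ≤ M → ToepShrinks a M c z := by
  obtain ⟨L, x, d, hx0, hd0, hd, hpos, hM⟩ := h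
  refine ⟨L, fun M hLM => ⟨fun i => x i, ?_⟩⟩
  have hn : l2 (fun i : Fin M => x i) ^ 2 = ∑ j ∈ Finset.range L, ‖x j‖ ^ 2 := by
    rw [l2_sq, Fin.sum_univ_eq_sum_range (fun j => ‖x j‖ ^ 2) M]
    refine (Finset.sum_subset (Finset.range_mono hLM) fun j _ hj => ?_).symm
    rw [hx0 j (by simpa using hj)]; simp
  have hl : 0 < l2 (fun i : Fin M => x i) := by
    refine (l2_nonneg _).lt_of_ne' fun h0 => ?_
    rw [h0] at hn
    rw [← hn] at hpos
    simp at hpos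
  refine ⟨ne_zero_of_l2_pos hl, ?_⟩
  refine (l2_le (c := d * l2 fun i : Fin M => x i) (by positivity) ?_).trans (by gcongr)
  rw [mul_pow, hn]
  refine le_trans (le_of_eq ?_) (hM M)
  rw [← Fin.sum_univ_eq_sum_range
    (fun i => ‖∑ j ∈ Finset.range L, a ((i : ℤ) - j) * x j - z * x i‖ ^ 2) M]
  refine Finset.sum_congr rfl fun i _ => ?_
  rw [toepM_sub_smul_mulVec, Fin.sum_univ_eq_sum_range (fun j => a ((i : ℤ) - j) * x j) M]
  congr 3
  refine (Finset.sum_subset (Finset.range_mono hLM) fun j _ hj => ?_).symm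
  rw [hx0 j (by simpa using hj)]; simp

lemma seqShrinks_of_support {a : ℤ → ℂ} (ha : Summable fun j => ‖a j‖) {M w : ℕ} {c c' : ℝ}
    {z : ℂ} (hc : 0 ≤ c) (hcc : c + ∑' j, wTail a w j < c') {y : Fin M → ℂ} (hy0 : y ≠ 0)
    (hy : ∀ q, y q ≠ 0 → (q : ℕ) + w ≤ M)
    (h : l2 ((ToepM a M - z • (1 : Matrix (Fin M) (Fin M) ℂ)) *ᵥ y) ≤ c * l2 y) :
    SeqShrinks a c' z := by
  set t := ∑' j, wTail a w j with ht
  have ht0 : 0 ≤ t := tsum_nonneg (wTail_nonneg a w)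
  set x : ℕ → ℂ := fun j => if h : j < M then y ⟨j, h⟩ else 0 with hxdef
  have hxy : ∀ i : Fin M, x i = y i := fun i => by simp [hxdef]
  have hxM : ∀ j, M ≤ j → x j = 0 := fun j hj => by simp [hxdef, not_lt.2 hj]
  have hn : ∑ j ∈ Finset.range M, ‖x j‖ ^ 2 = l2 y ^ 2 := by
    rw [l2_sq, ← Fin.sum_univ_eq_sum_range (fun j => ‖x j‖ ^ 2) M]
    simp only [hxy]
  have hpos := l2_pos hy0
  have hsum : ∀ i : ℕ, ∑ j ∈ Finset.range M, a ((i : ℤ) - j) * x j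
      = ∑ j : Fin M, a ((i : ℤ) - (j : ℕ)) * y j := fun i => by
    rw [← Fin.sum_univ_eq_sum_range (fun j => a ((i : ℤ) - j) * x j) M]
    simp only [hxy]
  refine ⟨M, x, c + t, hxM, by positivity, hcc, by rw [hn]; positivity, fun M' => ?_⟩
  rw [hn]
  calc _ ≤ ∑ i ∈ Finset.range (M + M'),
        ‖∑ j ∈ Finset.range M, a ((i : ℤ) - j) * x j - z * x i‖ ^ 2 :=
        Finset.sum_le_sum_of_subset_of_nonneg (Finset.range_mono (by omega))
          fun _ _ _ => by positivity
    _ ≤ (c * l2 y) ^ 2 + (t * l2 y) ^ 2 := by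
        rw [Finset.sum_range_add]
        refine add_le_add ?_ ?_
        · refine le_trans (le_of_eq ?_) (pow_le_pow_left₀ (l2_nonneg _) h 2)
          rw [l2_sq, ← Fin.sum_univ_eq_sum_range
            (fun i => ‖∑ j ∈ Finset.range M, a ((i : ℤ) - j) * x j - z * x i‖ ^ 2) M]
          refine Finset.sum_congr rfl fun i _ => ?_
          rw [toepM_sub_smul_mulVec, hsum, hxy]
        · let F : Matrix (Fin M') (Fin M) ℂ := fun i j =>
            if (j : ℕ) + w ≤ M then a (((M : ℤ) + i) - j) else 0
          have hF := l2_mulVec_le_tsum (F := F) (f := fun i => (M : ℤ) + i) (g := fun j => (j : ℤ))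
            (b := wTail a w) (fun i i' hi => by simp at hi; omega)
            (fun i i' hi => by simp at hi; omega) (wTail_nonneg a w) (summable_wTail ha w)
            (fun p q => by
              simp only [F]
              split_ifs with hq
              · unfold wTail
                rw [if_pos]
                rw [abs_of_nonneg] <;> omega
              · simpa using wTail_nonneg a w _) y
          refine le_trans (le_of_eq ?_) (pow_le_pow_left₀ (l2_nonneg _) hF 2)
          rw [l2_sq, ← Fin.sum_univ_eq_sum_range
            (fun i => ‖∑ j ∈ Finset.range M, a (((M + i : ℕ) : ℤ) - j) * x j
              - z * x (M + i)‖ ^ 2) M']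
          refine Finset.sum_congr rfl fun i _ => ?_
          rw [hxM (M + i) (by omega), hsum, mul_zero, sub_zero]
          congr 2
          refine Finset.sum_congr rfl fun j _ => ?_
          by_cases hj : y j = 0
          · simp [hj]
          · simp [F, hy j hj]
    _ ≤ (c + t) ^ 2 * l2 y ^ 2 := by
        nlinarith [mul_nonneg (mul_nonneg hc ht0) (sq_nonneg (l2 y))]

/-- A vector contracted by a large Toeplitz matrix can be localised away from one of the two
ends of the index range. -/
lemma seqShrinks_of_toepShrinks {a : ℤ → ℂ} (ha : Summable fun j => ‖a j‖) {M w n : ℕ}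
    (hw : 1 ≤ w) (hn : 1 ≤ n) (hM : (n + 2) * w ≤ M) {c c' : ℝ} {z : ℂ} (hc : 0 ≤ c)
    (hcc : c + 4 * (∑' j, ‖a j‖) * Real.sin (π / (2 * n + 2)) + 3 * (∑' j, wTail a w j) < c')
    (h : ToepShrinks a M c z) :
    SeqShrinks a c' z ∨ SeqShrinks (fun j => a (-j)) c' z := by
  classical
  obtain ⟨x, hx, h⟩ := h
  set W := ∑' j, ‖a j‖ with hW
  set t := ∑' j, wTail a w j with ht
  have hW0 : 0 ≤ W := tsum_nonneg fun _ => norm_nonneg _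
  have ht0 : 0 ≤ t := tsum_nonneg (wTail_nonneg a w)
  have hs0 : 0 ≤ Real.sin (π / (2 * n + 2)) := sin_pi_div_nonneg n
  set I : Matrix (Fin M) (Fin M) ℂ := 1
  let β : Fin M → ℤ := fun p => ((p : ℕ) / w : ℕ)
  let C : Matrix (Fin M) (Fin M) ℂ := fun p q => if |β p - β q| ≤ 1 then 0 else ToepM a M p q
  set B : Matrix (Fin M) (Fin M) ℂ := ToepM a M - z • I - C with hB
  have hval : Function.Injective (fun p : Fin M => ((p : ℕ) : ℤ)) := fun i i' hi => by
    simp at hi; omega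
  have hCn : ∀ v, l2 (C *ᵥ v) ≤ t * l2 v := by
    refine l2_mulVec_le_tsum hval hval (wTail_nonneg a w) (summable_wTail ha w) fun p q => ?_
    simp only [C]
    split_ifs with hpq
    · simpa using wTail_nonneg a w _
    · have hdist : (w : ℤ) ≤ |((p : ℕ) : ℤ) - (q : ℕ)| := by
        have h1 := Nat.div_add_mod (p : ℕ) w
        have h2 := Nat.div_add_mod (q : ℕ) w
        have h3 := Nat.mod_lt (p : ℕ) hw
        have h4 := Nat.mod_lt (q : ℕ) hw
        simp only [β] at hpq
        set u := (p : ℕ) / w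
        set v := (q : ℕ) / w
        rw [not_le, lt_abs] at hpq
        rw [le_abs]
        rcases hpq with hpq | hpq
        · have : w * (v + 2) ≤ w * u := Nat.mul_le_mul_left w (by omega)
          rw [Nat.mul_add] at this
          omega
        · have : w * (u + 2) ≤ w * v := Nat.mul_le_mul_left w (by omega)
          rw [Nat.mul_add] at this
          omega
      unfold wTail
      rw [if_pos hdist]
      rfl
  have hBpq : ∀ p q, p ≠ q → B p q = ToepM a M p q -
      if |β p - β q| ≤ 1 then 0 else ToepM a M p q := fun p q hne => by
    have hI : I p q = 0 := Matrix.one_apply_ne hne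
    rw [hB, Matrix.sub_apply, Matrix.sub_apply, Matrix.smul_apply, hI, smul_zero, sub_zero]
  have hoff : ∀ P : Fin M → Fin M → Prop, ∀ [∀ p q, Decidable (P p q)],
      (∀ p q, P p q → |β p - β q| = 1) →
      ∀ v, l2 ((fun p q => if P p q then B p q else 0 : Matrix (Fin M) (Fin M) ℂ) *ᵥ v)
        ≤ W * l2 v := by
    intro P _ hP
    refine l2_mulVec_le_tsum hval hval (fun _ => norm_nonneg _) ha fun p q => ?_
    split_ifs with hpq
    · have hne : p ≠ q := by rintro rfl; simpa using hP p p hpq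
      have h1 := hP p q hpq
      rw [hBpq p q hne, if_pos h1.le, sub_zero]
      rfl
    · simp
  have hBx : l2 (B *ᵥ x) ≤ (c + t) * l2 x := by
    rw [hB, sub_mulVec, sub_eq_add_neg]
    refine (l2_add_le _ _).trans ?_
    rw [l2_neg, add_mul]
    exact add_le_add h (hCn x)
  obtain ⟨k, y, hy0, hysupp, hy⟩ := exists_localized β B
    (fun p q => if β p = β q + 1 then B p q else 0)
    (fun p q => if β p = β q - 1 then B p q else 0) (fun _ _ => rfl) (fun _ _ => rfl)
    (fun p q hpq => by
      have hne : p ≠ q := by rintro rfl; simp at hpq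
      rw [hBpq p q hne, if_neg (not_le.2 hpq), sub_self]) hW0 hW0
    (hoff (fun p q => β p = β q + 1) fun p q hpq => by rw [hpq]; simp)
    (hoff (fun p q => β p = β q - 1) fun p q hpq => by rw [hpq]; simp)
    hn hx (by positivity) hBx
  set s := Real.sin (π / (2 * n + 2)) with hs
  have hAy : l2 ((ToepM a M - z • I) *ᵥ y) ≤ (c + 4 * W * s + 2 * t) * l2 y := by
    have : (ToepM a M - z • I) *ᵥ y = B *ᵥ y + C *ᵥ y := by
      rw [hB, sub_mulVec _ C, sub_add_cancel]
    rw [this]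
    refine (l2_add_le _ _).trans ((add_le_add hy (hCn y)).trans_eq ?_)
    ring
  have hdiv : ∀ p : Fin M, β p * w ≤ (p : ℕ) ∧ ((p : ℕ) : ℤ) < (β p + 1) * w := fun p => by
    have h1 := Nat.div_mul_le_self (p : ℕ) w
    have h2 : (p : ℕ) < ((p : ℕ) / w + 1) * w := by
      rw [mul_comm]; exact Nat.lt_mul_div_succ (p : ℕ) hw
    simp only [β]
    constructor
    · exact_mod_cast h1
    · exact_mod_cast h2
  by_cases hk : 0 ≤ k
  · right
    have hflip : ∑' j, wTail (fun j => a (-j)) w j = t := by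
      rw [ht, ← (Equiv.neg ℤ).tsum_eq]
      refine tsum_congr fun j => ?_
      simp [wTail]
    refine seqShrinks_of_support (a := fun j => a (-j)) (M := M) (w := w)
      (c := c + 4 * W * s + 2 * t) (y := y ∘ Fin.rev) ((Equiv.neg ℤ).summable_iff.2 ha)
      (by positivity) (by rw [hflip]; linarith)
      (ne_zero_of_l2_pos (by rw [l2_comp_rev]; exact l2_pos hy0)) (fun q hq => ?_) ?_
    · obtain ⟨h1, -⟩ := hysupp _ hq
      obtain ⟨h2, -⟩ := hdiv (Fin.rev q)
      have h3 := Fin.val_rev q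
      have h4 : (1 : ℤ) * w ≤ β (Fin.rev q) * w := by gcongr; omega
      omega
    · rw [toepM_flip_mulVec, l2_comp_rev, l2_comp_rev]
      simpa only [neg_neg] using hAy
  · left
    refine seqShrinks_of_support ha (by positivity) (by linarith) hy0 (fun q hq => ?_) hAy
    obtain ⟨-, h1⟩ := hysupp _ hq
    obtain ⟨-, h2⟩ := hdiv q
    have h3 : (β q + 1) * w ≤ ((n : ℤ) + 1) * w := by gcongr; omega
    have h4 : ((n : ℤ) + 2) * w ≤ M := by exact_mod_cast hM
    have h5 : ((n : ℤ) + 2) * w = ((n : ℤ) + 1) * w + w := by ring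
    omega

end FiniteToeplitz

end SpecIncl

namespace SpecIncl

section Approximation

open Matrix

lemma exists_eigenpair_near {ι : Type*} [Fintype ι] [DecidableEq ι] {A : Matrix ι ι ℂ}
    (hA : A.IsHermitian) {η : ℝ} {z : ℂ} {x : ι → ℂ} (hx : x ≠ 0)
    (h : l2 ((A - z • (1 : Matrix ι ι ℂ)) *ᵥ x) ≤ η * l2 x) :
    ∃ (z' : ℂ) (v : ι → ℂ), ‖z - z'‖ ≤ η ∧ v ≠ 0 ∧
      (A - z' • (1 : Matrix ι ι ℂ)) *ᵥ v = 0 := by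
  set b := hA.eigenvectorBasis with hb
  set u : EuclideanSpace ℂ ι := WithLp.toLp 2 x with hu
  have hpos : 0 < ‖u‖ := l2_pos hx
  have hη : 0 ≤ η := nonneg_of_mul_nonneg_left ((l2_nonneg _).trans h) (l2_pos hx)
  set f : EuclideanSpace ℂ ι := toEuclideanLin A u - z • u with hf
  have hfn : ‖f‖ ≤ η * ‖u‖ := by
    have : f = WithLp.toLp 2 ((A - z • (1 : Matrix ι ι ℂ)) *ᵥ x) := by
      rw [hf, sub_mulVec, smul_mulVec, one_mulVec]
      rfl
    rw [this]
    exact h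
  have hbi : ∀ i, toEuclideanLin A (b i) = (hA.eigenvalues i : ℂ) • b i := by
    intro i
    have := hA.mulVec_eigenvectorBasis i
    apply WithLp.ofLp_injective 2
    change A *ᵥ (b i).ofLp = _
    rw [this]
    ext j
    simp [hb]
  have hinner : ∀ i, inner ℂ (b i) f = ((hA.eigenvalues i : ℂ) - z) * inner ℂ (b i) u := by
    intro i
    have hs := (isSymmetric_toEuclideanLin_iff.mpr hA) (b i) u
    rw [hf, inner_sub_right, ← hs, hbi, inner_smul_left, inner_smul_right]
    simp [sub_mul]
  obtain ⟨i, hi⟩ : ∃ i, ‖z - (hA.eigenvalues i : ℂ)‖ ≤ η := by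
    by_contra! hcon
    have h1 := b.sum_sq_norm_inner_right f
    have h2 := b.sum_sq_norm_inner_right u
    obtain ⟨i, hi⟩ : ∃ i, inner ℂ (b i) u ≠ 0 := by
      by_contra! h0
      simp only [h0] at h2
      have h3 : 0 < ‖u‖ ^ 2 := by positivity
      rw [← h2] at h3
      simp at h3
    have hlt : ∑ i, η ^ 2 * ‖inner ℂ (b i) u‖ ^ 2 < ∑ i, ‖inner ℂ (b i) f‖ ^ 2 := by
      refine Finset.sum_lt_sum (fun j _ => ?_) ⟨i, Finset.mem_univ i, ?_⟩
      · rw [hinner, norm_mul, mul_pow, norm_sub_rev]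
        have := (hcon j).le
        gcongr
      · rw [hinner, norm_mul, mul_pow, norm_sub_rev]
        have := hcon i
        have := norm_pos_iff.2 hi
        gcongr
    rw [← Finset.mul_sum, h1, h2, ← mul_pow] at hlt
    exact absurd hlt (not_lt.2 (pow_le_pow_left₀ (norm_nonneg _) hfn 2))
  refine ⟨hA.eigenvalues i, (b i).ofLp, hi, ?_, ?_⟩
  · intro h0
    have : b i = 0 := WithLp.ofLp_injective 2 h0
    exact b.orthonormal.ne_zero i this
  · rw [sub_mulVec, smul_mulVec, one_mulVec]
    have := congrArg WithLp.ofLp (hbi i)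
    rw [sub_eq_zero]
    exact this

lemma toepM_isHermitian {a : ℤ → ℂ} (h : ∀ j : ℤ, a (-j) = (starRingEnd ℂ) (a j)) (M : ℕ) :
    (ToepM a M).IsHermitian := by
  ext i j
  rw [conjTranspose_apply]
  unfold ToepM
  rw [← neg_sub, h]
  exact star_star _

lemma tendsto_sin_pi_div :
    Filter.Tendsto (fun n : ℕ => Real.sin (π / (2 * n + 2))) Filter.atTop (nhds 0) := by
  have h1 : Filter.Tendsto (fun n : ℕ => (2 * (n : ℝ) + 2)) Filter.atTop Filter.atTop :=
    Filter.tendsto_atTop_add_const_right _ _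
      (tendsto_natCast_atTop_atTop.const_mul_atTop (by norm_num))
  have h2 := (Real.continuous_sin.tendsto 0).comp (h1.const_div_atTop π)
  rwa [Real.sin_zero] at h2

lemma exists_error_le {a : ℤ → ℂ} (ha : Summable fun j => ‖a j‖) {η : ℝ} (hη : 0 < η) :
    ∃ n₀ w₀ : ℕ, ∀ n w, n₀ ≤ n → w₀ ≤ w →
      4 * (∑' j, ‖a j‖) * Real.sin (π / (2 * n + 2)) + 3 * (∑' j, wTail a w j) < η := by
  have h1 := tendsto_sin_pi_div.const_mul (4 * ∑' j, ‖a j‖)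
  have h2 := (tendsto_tsum_wTail ha).const_mul 3
  rw [mul_zero] at h1 h2
  obtain ⟨n₀, hn⟩ := Filter.eventually_atTop.1 (h1.eventually (gt_mem_nhds (half_pos hη)))
  obtain ⟨w₀, hw⟩ := Filter.eventually_atTop.1 (h2.eventually (gt_mem_nhds (half_pos hη)))
  exact ⟨n₀, w₀, fun n w h h' => by linarith [hn n h, hw w h']⟩

instance : Nontrivial (lp (fun _ : ℕ => ℂ) 2) := by
  refine ⟨⟨lp.single 2 0 (1 : ℂ), 0, fun h => ?_⟩⟩
  have := congrArg (fun f : lp (fun _ : ℕ => ℂ) 2 => (f : ℕ → ℂ) 0) h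
  simp at this

variable {a : ℤ → ℂ} {T : lp (fun _ : ℕ => ℂ) 2 →L[ℂ] lp (fun _ : ℕ => ℂ) 2}

/-- The finite pseudospectra at a slightly larger level are close to `pspecOp ε T`. -/
lemma exists_mem_pspecOp_near (ha : Summable fun j => ‖a j‖)
    (hT : ∀ (x : lp (fun _ : ℕ => ℂ) 2) (i : ℕ),
      (T x : ℕ → ℂ) i = ∑' j : ℕ, a ((i : ℤ) - (j : ℤ)) * (x : ℕ → ℂ) j)
    {ε δ : ℝ} (hε : 0 ≤ ε) (hδ : 0 < δ) :
    ∃ η > 0, ∃ M₀ : ℕ, ∀ M, M₀ ≤ M → ∀ z, ToepShrinks a M (ε + η) z →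
      ∃ z' ∈ pspecOp ε T, ‖z - z'‖ ≤ δ := by
  obtain ⟨η, hη, h⟩ := exists_pspecOp_subset_thickening T hε hδ
  obtain ⟨n, w, hnw⟩ := exists_error_le ha (half_pos hη)
  refine ⟨η / 2, half_pos hη, (n + 1 + 2) * (w + 1), fun M hM z hz => h z ?_⟩
  rw [shrinks_iff_seqShrinks hT]
  refine seqShrinks_of_toepShrinks ha (w := w + 1) (n := n + 1) (by omega) (by omega) hM
    (by positivity) ?_ hz
  have := hnw (n + 1) (w + 1) (by omega) (by omega)
  linarith

lemma exists_toepShrinks_of_shrinks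
    (hT : ∀ (x : lp (fun _ : ℕ => ℂ) 2) (i : ℕ),
      (T x : ℕ → ℂ) i = ∑' j : ℕ, a ((i : ℤ) - (j : ℤ)) * (x : ℕ → ℂ) j)
    {c : ℝ} {z : ℂ} (h : Shrinks T c z) :
    ∃ L, ∀ M, L ≤ M → ToepShrinks a M c z := by
  rw [shrinks_iff_seqShrinks hT] at h
  rcases h with h | h
  · exact exists_toepShrinks_of_seqShrinks h
  · obtain ⟨L, hL⟩ := exists_toepShrinks_of_seqShrinks h
    exact ⟨L, fun M hM => toepShrinks_of_flip (hL M hM)⟩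

lemma exists_toepShrinks_near_of_mem
    (hT : ∀ (x : lp (fun _ : ℕ => ℂ) 2) (i : ℕ),
      (T x : ℕ → ℂ) i = ∑' j : ℕ, a ((i : ℤ) - (j : ℤ)) * (x : ℕ → ℂ) j)
    {ε δ : ℝ}
    (hε : 0 < ε ∨ ((∀ j : ℤ, a (-j) = (starRingEnd ℂ) (a j)) ∧ 0 ≤ ε)) (hδ : 0 < δ) {z : ℂ}
    (hz : z ∈ pspecOp ε T) :
    ∃ L, ∀ M, L ≤ M → ∃ z', ‖z - z'‖ ≤ δ ∧ ToepShrinks a M ε z' := by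
  by_cases hε0 : 0 < ε
  · obtain ⟨w, hw, hsh⟩ := exists_shrinks_near T hε0 hδ hz
    obtain ⟨L, hL⟩ := exists_toepShrinks_of_shrinks hT hsh
    exact ⟨L, fun M hM => ⟨w, hw, hL M hM⟩⟩
  · obtain ⟨hherm, h0⟩ := hε.resolve_left hε0
    have hε' : ε = 0 := le_antisymm (not_lt.1 hε0) h0
    subst hε'
    obtain ⟨L, hL⟩ := exists_toepShrinks_of_shrinks hT ((mem_pspecOp_iff le_rfl).1 hz δ hδ)
    refine ⟨L, fun M hM => ?_⟩
    obtain ⟨x, hx, h⟩ := hL M hM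
    obtain ⟨z', v, hz', hv, hAv⟩ := exists_eigenpair_near (toepM_isHermitian hherm M) hx h
    exact ⟨z', hz', v, hv, by rw [hAv, l2_zero, zero_mul]⟩

/-- The points of `pspecOp ε T` are uniformly close to the finite pseudospectra. -/
lemma exists_toepShrinks_near
    (hT : ∀ (x : lp (fun _ : ℕ => ℂ) 2) (i : ℕ),
      (T x : ℕ → ℂ) i = ∑' j : ℕ, a ((i : ℤ) - (j : ℤ)) * (x : ℕ → ℂ) j)
    {ε δ : ℝ}
    (hε : 0 < ε ∨ ((∀ j : ℤ, a (-j) = (starRingEnd ℂ) (a j)) ∧ 0 ≤ ε)) (hδ : 0 < δ) :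
    ∃ M₀ : ℕ, ∀ M, M₀ ≤ M → ∀ z ∈ pspecOp ε T, ∃ z', ‖z - z'‖ ≤ δ ∧ ToepShrinks a M ε z' := by
  have hε0 : 0 ≤ ε := hε.elim le_of_lt fun h => h.2
  have hbd : pspecOp ε T ⊆ Metric.closedBall 0 (‖T‖ + (ε + 1)) := fun z hz => by
    rw [mem_closedBall_zero_iff]
    exact (norm_lt_of_shrinks ((mem_pspecOp_iff hε0).1 hz (ε + 1) (by linarith))).le
  obtain ⟨t, ht, htf, hcov⟩ := Metric.finite_approx_of_totallyBounded
    ((isCompact_closedBall (0 : ℂ) (‖T‖ + (ε + 1))).totallyBounded.subset hbd) (δ / 2)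
    (half_pos hδ)
  have hL : ∀ p : t, ∃ L, ∀ M, L ≤ M → ∃ z', ‖(p : ℂ) - z'‖ ≤ δ / 2 ∧ ToepShrinks a M ε z' :=
    fun p => exists_toepShrinks_near_of_mem hT hε (half_pos hδ) (ht p.2)
  choose L hL using hL
  have : Finite t := htf
  obtain ⟨M₀, hM₀⟩ := (Set.finite_range L).bddAbove
  refine ⟨M₀, fun M hM z hz => ?_⟩
  obtain ⟨p, hp, hzp⟩ := Set.mem_iUnion₂.1 (hcov hz)
  obtain ⟨z', hz', hsh⟩ := hL ⟨p, hp⟩ M ((hM₀ ⟨_, rfl⟩).trans hM)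
  refine ⟨z', ?_, hsh⟩
  have h1 : ‖z - p‖ < δ / 2 := by rwa [Metric.mem_ball, dist_eq_norm] at hzp
  have h2 := norm_sub_le_norm_sub_add_norm_sub z p z'
  have h3 : ‖p - z'‖ ≤ δ / 2 := hz'
  linarith

end Approximation

end SpecIncl

namespace SpecIncl

section Blocks

open Matrix

variable {N : ℕ} {m : Fin N → ℕ}

lemma blockIndex_ext {p q : (i : Fin N) × Fin (m i)} (h1 : (p.1 : ℕ) = q.1)
    (h2 : (p.2 : ℕ) = q.2) : p = q := by
  obtain ⟨i, α⟩ := p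
  obtain ⟨j, β⟩ := q
  obtain rfl : i = j := Fin.ext h1
  obtain rfl : α = β := Fin.ext h2
  rfl

lemma blockMat_eq_add (A : ∀ i j : Fin N, Matrix (Fin (m i)) (Fin (m j)) ℂ) :
    blockMat m A = blockMat m (triPart A) + blockMat m (remPart A) := by
  ext p q
  simp only [blockMat, triPart, remPart, Matrix.add_apply]
  split_ifs <;> simp

/-- A block matrix whose block pattern is a partial permutation has norm at most the largest
norm of its blocks. -/
lemma l2_blockPerm_mulVec_le {A : ∀ i j : Fin N, Matrix (Fin (m i)) (Fin (m j)) ℂ}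
    {R : Fin N → Fin N → Prop} [∀ i j, Decidable (R i j)]
    (hrow : ∀ i j j', R i j → R i j' → j = j') (hcol : ∀ i i' j, R i j → R i' j → i = i')
    {r : ℝ} (hr0 : 0 ≤ r) (hr : ∀ i j, R i j → opNorm (A i j) ≤ r)
    {F : Matrix ((i : Fin N) × Fin (m i)) ((i : Fin N) × Fin (m i)) ℂ}
    (hF : ∀ p q, F p q = if R p.1 q.1 then A p.1 q.1 p.2 q.2 else 0)
    (x : ((i : Fin N) × Fin (m i)) → ℂ) : l2 (F *ᵥ x) ≤ r * l2 x := by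
  set X : ∀ j : Fin N, Fin (m j) → ℂ := fun j β => x ⟨j, β⟩ with hX
  have hent : ∀ i α, (F *ᵥ x) ⟨i, α⟩ = ∑ j, if R i j then (A i j *ᵥ X j) α else 0 := by
    intro i α
    change ∑ q, F ⟨i, α⟩ q * x q = _
    rw [Fintype.sum_sigma]
    refine Finset.sum_congr rfl fun j _ => ?_
    simp only [hF]
    split_ifs
    · rfl
    · simp
  have hblock : ∀ i, ∑ α, ‖(F *ᵥ x) ⟨i, α⟩‖ ^ 2
      ≤ ∑ j, if R i j then (r * l2 (X j)) ^ 2 else 0 := by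
    intro i
    by_cases hi : ∃ j, R i j
    · obtain ⟨j, hj⟩ := hi
      have hne : ∀ j', j' ≠ j → ¬ R i j' := fun j' hj' h => hj' (hrow i j' j h hj)
      rw [Finset.sum_eq_single j (fun j' _ hj' => if_neg (hne j' hj')) (by simp), if_pos hj]
      have h1 : ∀ α, (F *ᵥ x) ⟨i, α⟩ = (A i j *ᵥ X j) α := fun α => by
        rw [hent, Finset.sum_eq_single j (fun j' _ hj' => if_neg (hne j' hj')) (by simp),
          if_pos hj]
      simp only [h1]
      rw [← l2_sq]
      refine pow_le_pow_left₀ (l2_nonneg _) ((l2_mulVec_le_opNorm _ _).trans ?_) 2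
      exact mul_le_mul_of_nonneg_right (hr i j hj) (l2_nonneg _)
    · push Not at hi
      simp [hent, hi]
  refine l2_le (mul_nonneg hr0 (l2_nonneg x)) ?_
  rw [Fintype.sum_sigma]
  refine (Finset.sum_le_sum fun i _ => hblock i).trans ?_
  rw [Finset.sum_comm, mul_pow, l2_sq, Fintype.sum_sigma, Finset.mul_sum]
  refine Finset.sum_le_sum fun j _ => ?_
  rw [← l2_sq (X j), ← mul_pow]
  by_cases hj : ∃ i, R i j
  · obtain ⟨i, hi⟩ := hj
    rw [Finset.sum_eq_single i (fun i' _ hi' => if_neg fun h => hi' (hcol i' i j h hi)) (by simp),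
      if_pos hi]
  · push Not at hj
    simp only [hj, if_false, Finset.sum_const_zero]
    positivity

variable (A : ∀ i j : Fin N, Matrix (Fin (m i)) (Fin (m j)) ℂ)

lemma rL_nonneg : 0 ≤ rL A := by
  refine Real.sSup_nonneg ?_
  rintro y ⟨i, j, -, rfl⟩
  exact opNorm_nonneg _

lemma rU_nonneg : 0 ≤ rU A := by
  refine Real.sSup_nonneg ?_
  rintro y ⟨i, j, -, rfl⟩
  exact opNorm_nonneg _

lemma opNorm_le_rL {i j : Fin N} (h : (j : ℕ) + 1 = i) : opNorm (A i j) ≤ rL A := by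
  refine le_csSup (Set.Finite.bddAbove ?_) ⟨i, j, h, rfl⟩
  refine (Set.finite_range fun p : Fin N × Fin N => opNorm (A p.1 p.2)).subset ?_
  rintro y ⟨i, j, -, rfl⟩
  exact ⟨(i, j), rfl⟩

lemma opNorm_le_rU {i j : Fin N} (h : (i : ℕ) + 1 = j) : opNorm (A i j) ≤ rU A := by
  refine le_csSup (Set.Finite.bddAbove ?_) ⟨i, j, h, rfl⟩
  refine (Set.finite_range fun p : Fin N × Fin N => opNorm (A p.1 p.2)).subset ?_
  rintro y ⟨i, j, -, rfl⟩
  exact ⟨(i, j), rfl⟩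

variable {A}

/-- The embedding of the block index set of a window into the full block index set. -/
def windowEmb (m : Fin N → ℕ) {n k : ℕ} (h : k + n ≤ N)
    (q : (j : Fin n) × Fin (m (widx h j))) : (i : Fin N) × Fin (m i) := ⟨widx h q.1, q.2⟩

lemma windowEmb_injective {n k : ℕ} (h : k + n ≤ N) :
    Function.Injective (windowEmb m h) := by
  rintro ⟨i, α⟩ ⟨j, β⟩ hpq
  have h1 := congrArg (fun p : (i : Fin N) × Fin (m i) => (p.1 : ℕ)) hpq
  have h2 := congrArg (fun p : (i : Fin N) × Fin (m i) => (p.2 : ℕ)) hpq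
  simp only [windowEmb, widx] at h1 h2
  obtain rfl : i = j := Fin.ext (by omega)
  obtain rfl : α = β := Fin.ext h2
  rfl

lemma mem_range_windowEmb {n k : ℕ} (h : k + n ≤ N) {p : (i : Fin N) × Fin (m i)}
    (h1 : k ≤ (p.1 : ℕ)) (h2 : (p.1 : ℕ) < k + n) : p ∈ Set.range (windowEmb m h) := by
  obtain ⟨i, α⟩ := p
  obtain ⟨j, rfl⟩ : ∃ j, widx h j = i :=
    ⟨⟨(i : ℕ) - k, Nat.sub_lt_left_of_lt_add h1 h2⟩, Fin.ext (Nat.add_sub_of_le h1)⟩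
  exact ⟨⟨j, α⟩, rfl⟩

lemma sb_eq (b : ∀ i j : Fin N, Matrix (Fin (m i)) (Fin (m j)) ℂ)
    (p q : (i : Fin N) × Fin (m i)) :
    sb b ((p.1 : ℕ) : ℤ) ((q.1 : ℕ) : ℤ) p.2 q.2 = b p.1 q.1 p.2 q.2 := by
  have hp := p.1.isLt
  have hq := q.1.isLt
  unfold sb
  rw [dif_pos ⟨by omega, by omega⟩, dif_pos ⟨by omega, by omega⟩]
  exact (dif_pos p.2.isLt).trans (dif_pos q.2.isLt)

lemma rsz_natCast (i : Fin N) : rsz m ((i : ℕ) : ℤ) = m i := by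
  have := i.isLt
  unfold rsz
  rw [dif_pos ⟨by omega, by omega⟩]
  rfl

lemma l2_Bplus_mulVec {b : ∀ i j : Fin N, Matrix (Fin (m i)) (Fin (m j)) ℂ}
    (hb : ∀ i j : Fin N, 1 < |((i : ℕ) : ℤ) - (j : ℕ)| → b i j = 0) {n k : ℕ} (h : k + n ≤ N)
    (z : ℂ) {y : ((i : Fin N) × Fin (m i)) → ℂ}
    (hy : ∀ p, p ∉ Set.range (windowEmb m h) → y p = 0) :
    l2 ((Bplus b n k h - z • IplusMat m n k h) *ᵥ (y ∘ windowEmb m h))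
      = l2 ((blockMat m b - z • (1 : Matrix ((i : Fin N) × Fin (m i)) _ ℂ)) *ᵥ y) := by
  set G := (blockMat m b - z • (1 : Matrix ((i : Fin N) × Fin (m i)) _ ℂ)) with hG
  let g1 : ((i : Fin (n + 2)) × Fin (rsz m ((k : ℤ) - 1 + i))) → ℤ × ℕ :=
    fun p => ((k : ℤ) - 1 + (p.1 : ℕ), (p.2 : ℕ))
  let g2 : ((i : Fin N) × Fin (m i)) → ℤ × ℕ := fun p => ((p.1 : ℕ), (p.2 : ℕ))
  have hg1 : Function.Injective g1 := by
    rintro ⟨i, α⟩ ⟨j, β⟩ hpq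
    simp only [g1, Prod.mk.injEq] at hpq
    obtain rfl : i = j := Fin.ext (by omega)
    obtain rfl : α = β := Fin.ext hpq.2
    rfl
  have hg2 : Function.Injective g2 := by
    intro p q hpq
    simp only [g2, Prod.mk.injEq] at hpq
    exact blockIndex_ext (by omega) hpq.2
  have hGy : ∀ p, (G *ᵥ y) p = ∑ q, G p (windowEmb m h q) * y (windowEmb m h q) := fun p =>
    (Fintype.sum_of_injective _ (windowEmb_injective h) _ _
      (fun q hq => by rw [hy q hq, mul_zero]) (fun _ => rfl)).symm
  set V : ℤ × ℕ → ℝ := Function.extend g2 (fun p => ‖(G *ᵥ y) p‖ ^ 2) 0 with hV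
  have hrow : ∀ p, ‖((Bplus b n k h - z • IplusMat m n k h) *ᵥ (y ∘ windowEmb m h)) p‖ ^ 2
      = V (g1 p) := by
    intro p
    by_cases hp : g1 p ∈ Set.range g2
    · obtain ⟨p', hp'⟩ := hp
      rw [← hp', hV, hg2.extend_apply, hGy]
      congr 2
      refine Finset.sum_congr rfl fun q _ => ?_
      simp only [g1, g2, Prod.mk.injEq] at hp'
      congr 1
      have h1 : Bplus b n k h p q = blockMat m b p' (windowEmb m h q) := by
        have := sb_eq b p' (windowEmb m h q)
        rw [hp'.1, hp'.2] at this
        exact this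
      have h2 : IplusMat m n k h p q
          = (1 : Matrix ((i : Fin N) × Fin (m i)) _ ℂ) p' (windowEmb m h q) := by
        rw [Matrix.one_apply]
        unfold IplusMat
        refine if_congr ⟨fun hpq => blockIndex_ext ?_ ?_, fun hpq => ?_⟩ rfl rfl
        · simp only [windowEmb, widx]; omega
        · simp only [windowEmb]; omega
        · rw [hpq] at hp'
          simp only [windowEmb, widx] at hp'
          omega
      change (Bplus b n k h - z • IplusMat m n k h) p q = _
      rw [hG, Matrix.sub_apply, Matrix.sub_apply, Matrix.smul_apply, Matrix.smul_apply, h1, h2]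
    · have hI : ¬ (0 ≤ (k : ℤ) - 1 + (p.1 : ℕ) ∧ (k : ℤ) - 1 + (p.1 : ℕ) < N) := by
        intro hI
        refine hp ⟨⟨⟨((k : ℤ) - 1 + (p.1 : ℕ)).toNat, by omega⟩, ⟨p.2, ?_⟩⟩, ?_⟩
        · exact p.2.isLt.trans_eq (dif_pos hI)
        · exact Prod.ext (Int.toNat_of_nonneg hI.1) rfl
      rw [hV, Function.extend_apply' _ _ _ hp]
      have : ((Bplus b n k h - z • IplusMat m n k h) *ᵥ (y ∘ windowEmb m h)) p = 0 := by
        refine Finset.sum_eq_zero fun q _ => ?_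
        have h1 : Bplus b n k h p q = 0 := by
          unfold Bplus sb
          rw [dif_neg hI]
        have h2 : IplusMat m n k h p q = 0 := by
          unfold IplusMat
          rw [if_neg]
          rintro ⟨h1, -⟩
          have := q.1.isLt
          omega
        change (Bplus b n k h - z • IplusMat m n k h) p q * _ = 0
        rw [Matrix.sub_apply, Matrix.smul_apply, h1, h2]
        simp
      simp [this]
  have hsupp : Function.support V ⊆ Set.range g1 := by
    intro u hu
    by_cases hu2 : u ∈ Set.range g2
    · obtain ⟨p, rfl⟩ := hu2
      rw [Function.mem_support, hV, hg2.extend_apply, hGy] at hu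
      obtain ⟨q, hq⟩ : ∃ q, G p (windowEmb m h q) ≠ 0 := by
        by_contra! h0
        simp [h0] at hu
      have hdist : |((p.1 : ℕ) : ℤ) - ((widx h q.1 : Fin N) : ℕ)| ≤ 1 := by
        by_contra! hlt
        apply hq
        have hne : p ≠ windowEmb m h q := by
          rintro rfl
          simp [windowEmb] at hlt
        rw [hG, Matrix.sub_apply, Matrix.smul_apply, Matrix.one_apply_ne hne]
        simp only [blockMat]
        rw [hb p.1 (windowEmb m h q).1 hlt]
        simp
      rw [abs_le] at hdist
      simp only [widx] at hdist
      have hqn := q.1.isLt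
      have hk : (k : ℤ) - 1 + ((p.1 : ℕ) + 1 - k : ℕ) = (p.1 : ℕ) := by omega
      refine ⟨⟨⟨(p.1 : ℕ) + 1 - k, by omega⟩, ⟨p.2, ?_⟩⟩, ?_⟩
      · rw [hk, rsz_natCast]
        exact p.2.isLt
      · exact Prod.ext hk rfl
    · exact absurd (Function.extend_apply' _ _ _ hu2) hu
  rw [← sq_eq_sq₀ (l2_nonneg _) (l2_nonneg _), l2_sq, l2_sq]
  simp only [hrow]
  rw [← tsum_fintype (L := .unconditional _), ← tsum_fintype (L := .unconditional _),
    hg1.tsum_eq hsupp, hV, tsum_extend_zero hg2]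

lemma triPart_eq_zero {i j : Fin N} (h : 1 < |((i : ℕ) : ℤ) - (j : ℕ)|) : triPart A i j = 0 :=
  if_neg (not_le.2 h)

/-- The pseudospectrum of a block matrix is contained in its inclusion set. -/
lemma mem_gammaTau1_of_l2_le {n : ℕ} (hn : 1 ≤ n) (hnN : n ≤ N) {ε : ℝ} (hε : 0 ≤ ε) {z : ℂ}
    {x : ((i : Fin N) × Fin (m i)) → ℂ} (hx : x ≠ 0)
    (h : l2 ((blockMat m A - z • (1 : Matrix ((i : Fin N) × Fin (m i)) _ ℂ)) *ᵥ x) ≤ ε * l2 x) :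
    z ∈ GammaTau1 A n hnN ε := by
  set I : Matrix ((i : Fin N) × Fin (m i)) ((i : Fin N) × Fin (m i)) ℂ := 1 with hI
  set B := blockMat m (triPart A) - z • I with hB
  set C := blockMat m (remPart A) with hC
  have hBx : l2 (B *ᵥ x) ≤ (ε + opNorm C) * l2 x := by
    have : B *ᵥ x = (blockMat m A - z • I) *ᵥ x + -(C *ᵥ x) := by
      rw [hB, blockMat_eq_add A, ← neg_mulVec, ← add_mulVec]
      congr 1
      abel
    rw [this, add_mul]
    refine (l2_add_le _ _).trans (add_le_add h ?_)
    rw [l2_neg]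
    exact l2_mulVec_le_opNorm C x
  have hBne : ∀ p q, p ≠ q → B p q = triPart A p.1 q.1 p.2 q.2 := fun p q hne => by
    have hIpq : I p q = 0 := Matrix.one_apply_ne hne
    rw [hB, Matrix.sub_apply, Matrix.smul_apply, hIpq, smul_zero, sub_zero]
    rfl
  obtain ⟨k', y, hy0, hysupp, hy⟩ := exists_localized (fun p => ((p.1 : ℕ) : ℤ)) B
    (fun p q => if ((p.1 : ℕ) : ℤ) = ((q.1 : ℕ) : ℤ) + 1 then B p q else 0)
    (fun p q => if ((p.1 : ℕ) : ℤ) = ((q.1 : ℕ) : ℤ) - 1 then B p q else 0)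
    (fun _ _ => rfl) (fun _ _ => rfl)
    (fun p q hpq => by
      rw [hBne p q (by rintro rfl; simp at hpq), triPart_eq_zero hpq]
      rfl)
    (rL_nonneg A) (rU_nonneg A)
    (l2_blockPerm_mulVec_le (A := A) (R := fun i j => ((i : ℕ) : ℤ) = ((j : ℕ) : ℤ) + 1)
      (fun i j j' h1 h2 => Fin.ext (by omega)) (fun i i' j h1 h2 => Fin.ext (by omega))
      (rL_nonneg A) (fun i j hij => opNorm_le_rL A (by omega)) (fun p q => by
        split_ifs with hpq
        · rw [hBne p q (by rintro rfl; simp at hpq)]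
          simp only [triPart]
          rw [if_pos (by rw [hpq]; simp)]
        · rfl))
    (l2_blockPerm_mulVec_le (A := A) (R := fun i j => ((i : ℕ) : ℤ) = ((j : ℕ) : ℤ) - 1)
      (fun i j j' h1 h2 => Fin.ext (by omega)) (fun i i' j h1 h2 => Fin.ext (by omega))
      (rU_nonneg A) (fun i j hij => opNorm_le_rU A (by omega)) (fun p q => by
        split_ifs with hpq
        · rw [hBne p q (by rintro rfl; omega)]
          simp only [triPart]
          rw [if_pos (by rw [hpq]; simp)]
        · rfl))
    hn hx (add_nonneg hε (opNorm_nonneg C)) hBx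
  obtain ⟨k, hk⟩ : ∃ k : Fin (N - n + 1),
      ((k : ℕ) : ℤ) = max 0 (min (k' + 1) ((N : ℤ) - n)) :=
    ⟨⟨(max 0 (min (k' + 1) ((N : ℤ) - n))).toNat, by omega⟩, by simp⟩
  have hyr : ∀ p, p ∉ Set.range (windowEmb m (kwin hnN k)) → y p = 0 := by
    intro p hp
    by_contra hyp
    have h1 := hysupp p hyp
    have h2 := p.1.isLt
    exact hp (mem_range_windowEmb _ (by omega) (by omega))
  refine Set.mem_iUnion.2 ⟨k, ?_⟩
  have hl : l2 (y ∘ windowEmb m (kwin hnN k)) = l2 y := l2_comp (windowEmb_injective _) hyr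
  refine sval_le _ (x := y ∘ windowEmb m (kwin hnN k))
    (ne_zero_of_l2_pos (by rw [hl]; exact l2_pos hy0)) ?_
  rw [l2_Bplus_mulVec (fun i j hij => triPart_eq_zero hij) _ z hyr, hl]
  refine hy.trans_eq ?_
  unfold epsTau1 rA
  ring

lemma exists_l2_le_of_mem_gammaTau1 {n : ℕ} (hn : 1 ≤ n) (hnN : n ≤ N) (hm : ∀ i, 0 < m i)
    {ε η : ℝ} (hη : 0 < η) {z : ℂ} (hz : z ∈ GammaTau1 A n hnN ε) :
    ∃ x : ((i : Fin N) × Fin (m i)) → ℂ, x ≠ 0 ∧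
      l2 ((blockMat m A - z • (1 : Matrix ((i : Fin N) × Fin (m i)) _ ℂ)) *ᵥ x)
        ≤ (ε + epsTau1 A n + opNorm (blockMat m (remPart A)) + η) * l2 x := by
  obtain ⟨k, hk⟩ := Set.mem_iUnion.1 hz
  have hk : sval (Bplus (triPart A) n k (kwin hnN k) - z • IplusMat m n k (kwin hnN k))
    < ε + epsTau1 A n + η := lt_of_le_of_lt hk (by linarith)
  have : Nonempty ((j : Fin n) × Fin (m (widx (kwin hnN k) j))) := ⟨⟨⟨0, hn⟩, ⟨0, hm _⟩⟩⟩
  obtain ⟨u, hu, hlt⟩ := exists_of_sval_lt hk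
  set e := windowEmb m (kwin hnN k) with he
  have heinj : Function.Injective e := windowEmb_injective _
  set x := Function.extend e u 0 with hx
  have hxe : x ∘ e = u := funext fun q => heinj.extend_apply _ _ _
  have hx0 : ∀ p, p ∉ Set.range e → x p = 0 := fun p hp => Function.extend_apply' _ _ _ hp
  have hl : l2 u = l2 x := by rw [← hxe]; exact l2_comp heinj hx0
  refine ⟨x, ne_zero_of_l2_pos (by rw [← hl]; exact l2_pos hu), ?_⟩
  rw [← hxe, l2_Bplus_mulVec (fun i j hij => triPart_eq_zero hij) _ z hx0, hxe, hl] at hlt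
  have hsplit : (blockMat m A - z • (1 : Matrix ((i : Fin N) × Fin (m i)) _ ℂ)) *ᵥ x
      = (blockMat m (triPart A) - z • (1 : Matrix ((i : Fin N) × Fin (m i)) _ ℂ)) *ᵥ x
        + blockMat m (remPart A) *ᵥ x := by
    rw [blockMat_eq_add A, ← add_mulVec]
    congr 1
    abel
  rw [hsplit]
  refine (l2_add_le _ _).trans ((add_le_add hlt.le (l2_mulVec_le_opNorm _ x)).trans_eq ?_)
  ring

end Blocks

end SpecIncl

namespace SpecIncl

section ToeplitzBlocks

open Matrix

variable {N M : ℕ} {m : Fin N → ℕ}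

lemma offset_add_le {i j : Fin N} (hij : i < j) : offset m i + m i ≤ offset m j := by
  have h : insert i (Finset.univ.filter (fun k => k < i)) ⊆
      Finset.univ.filter (fun k => k < j) := by
    intro k hk
    rcases Finset.mem_insert.1 hk with rfl | hk
    · simpa using hij
    · simpa using ((Finset.mem_filter.1 hk).2).trans hij
  have h3 := Finset.sum_le_sum_of_subset h (f := m)
  rw [Finset.sum_insert (by simp)] at h3
  unfold offset
  omega

/-- The position of a block index in the flat index set. -/
def flatPos (m : Fin N → ℕ) (p : (i : Fin N) × Fin (m i)) : ℤ := ((offset m p.1 + p.2 : ℕ) : ℤ)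

lemma flatPos_lt {p q : (i : Fin N) × Fin (m i)} (h : p.1 < q.1) : flatPos m p < flatPos m q := by
  have h1 := offset_add_le (m := m) h
  have h2 := p.2.isLt
  unfold flatPos
  omega

lemma flatPos_injective : Function.Injective (flatPos m) := by
  intro p q hpq
  rcases lt_trichotomy p.1 q.1 with h | h | h
  · exact absurd hpq (flatPos_lt h).ne
  · refine blockIndex_ext (by rw [h]) ?_
    have ho : offset m p.1 = offset m q.1 := by rw [h]
    unfold flatPos at hpq
    omega
  · exact absurd hpq (flatPos_lt h).ne'

lemma add_le_flatPos {w : ℕ} (hw : ∀ i, w ≤ m i) {p q : (i : Fin N) × Fin (m i)}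
    (h : (p.1 : ℕ) + 1 < q.1) : flatPos m p + w ≤ flatPos m q := by
  have hq := q.1.isLt
  have h1 := offset_add_le (m := m) (i := p.1) (j := ⟨(p.1 : ℕ) + 1, by omega⟩)
    (by rw [Fin.lt_def]; simp)
  have h2 := offset_add_le (m := m) (i := ⟨(p.1 : ℕ) + 1, by omega⟩) (j := q.1)
    (by rw [Fin.lt_def]; exact h)
  have h3 := p.2.isLt
  have h4 := hw ⟨(p.1 : ℕ) + 1, by omega⟩
  unfold flatPos
  omega

lemma le_abs_flatPos_sub {w : ℕ} (hw : ∀ i, w ≤ m i) {p q : (i : Fin N) × Fin (m i)}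
    (h : 1 < |((p.1 : ℕ) : ℤ) - (q.1 : ℕ)|) : (w : ℤ) ≤ |flatPos m p - flatPos m q| := by
  rw [lt_abs] at h
  rw [le_abs]
  rcases h with h | h
  · have := add_le_flatPos hw (p := q) (q := p) (by omega)
    left; omega
  · have := add_le_flatPos hw (p := p) (q := q) (by omega)
    right; omega

/-- The identification of the block index set with the flat index set. -/
def flatEquiv (hsum : ∑ i, m i = M) : ((i : Fin N) × Fin (m i)) ≃ Fin M :=
  Equiv.ofBijective (fun p => ⟨offset m p.1 + p.2, offset_add_lt hsum p.1 p.2⟩) <| by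
    refine (Fintype.bijective_iff_injective_and_card _).2 ⟨fun p q hpq => ?_, by simp [hsum]⟩
    refine flatPos_injective ?_
    unfold flatPos
    exact congrArg Nat.cast (congrArg Fin.val hpq)

lemma toepShrinks_iff_block (a : ℤ → ℂ) (hsum : ∑ i, m i = M) (c : ℝ) (z : ℂ) :
    ToepShrinks a M c z ↔ ∃ x : ((i : Fin N) × Fin (m i)) → ℂ, x ≠ 0 ∧
      l2 ((blockMat m (blocksOf (ToepM a M) m hsum)
        - z • (1 : Matrix ((i : Fin N) × Fin (m i)) _ ℂ)) *ᵥ x) ≤ c * l2 x := by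
  set e := flatEquiv hsum with he
  have hsub : blockMat m (blocksOf (ToepM a M) m hsum)
      - z • (1 : Matrix ((i : Fin N) × Fin (m i)) _ ℂ)
      = (ToepM a M - z • (1 : Matrix (Fin M) (Fin M) ℂ)).submatrix e e := by
    rw [submatrix_sub, submatrix_smul, Pi.sub_apply, Pi.sub_apply, Pi.smul_apply, Pi.smul_apply,
      submatrix_one_equiv]
    rfl
  have hl : ∀ y : Fin M → ℂ, l2 (y ∘ e) = l2 y := fun y =>
    l2_comp e.injective fun p hp => absurd (e.surjective p) hp
  have hl' : ∀ y : ((i : Fin N) × Fin (m i)) → ℂ, l2 (y ∘ e.symm) = l2 y := fun y =>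
    l2_comp e.symm.injective fun p hp => absurd (e.symm.surjective p) hp
  rw [hsub]
  constructor
  · rintro ⟨x, hx, h⟩
    refine ⟨x ∘ e, ne_zero_of_l2_pos (by rw [hl]; exact l2_pos hx), ?_⟩
    rw [submatrix_mulVec_equiv, hl, hl, Function.comp_assoc, e.self_comp_symm, Function.comp_id]
    exact h
  · rintro ⟨x, hx, h⟩
    refine ⟨x ∘ e.symm, ne_zero_of_l2_pos (by rw [hl']; exact l2_pos hx), ?_⟩
    rwa [submatrix_mulVec_equiv, hl, ← hl' x] at h

variable {a : ℤ → ℂ}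

lemma opNorm_blocksOf_toepM_le (ha : Summable fun j => ‖a j‖) (hsum : ∑ i, m i = M)
    (i j : Fin N) :
    opNorm (blocksOf (ToepM a M) m hsum i j) ≤ ∑' j, ‖a j‖ := by
  refine opNorm_le (tsum_nonneg fun _ => norm_nonneg _) ?_
  refine l2_mulVec_le_tsum (f := fun α => flatPos m ⟨i, α⟩) (g := fun β => flatPos m ⟨j, β⟩)
    (fun α α' h => ?_) (fun α α' h => ?_) (fun _ => norm_nonneg _) ha fun p q => le_rfl
  · simpa using flatPos_injective h
  · simpa using flatPos_injective h

lemma opNorm_remPart_toepM_le (ha : Summable fun j => ‖a j‖) (hsum : ∑ i, m i = M)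
    {w : ℕ} (hw : ∀ i, w ≤ m i) :
    opNorm (blockMat m (remPart (blocksOf (ToepM a M) m hsum))) ≤ ∑' j, wTail a w j := by
  refine opNorm_le (tsum_nonneg (wTail_nonneg a w)) ?_
  refine l2_mulVec_le_tsum flatPos_injective flatPos_injective (wTail_nonneg a w)
    (summable_wTail ha w) fun p q => ?_
  simp only [blockMat, remPart]
  split_ifs with hpq
  · simpa using wTail_nonneg a w _
  · unfold wTail
    rw [if_pos (le_abs_flatPos_sub hw (not_le.1 hpq))]
    rfl

lemma epsTau1_toepM_le (ha : Summable fun j => ‖a j‖) (hsum : ∑ i, m i = M)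
    {w : ℕ} (hw : ∀ i, w ≤ m i) (n : ℕ) :
    epsTau1 (blocksOf (ToepM a M) m hsum) n
      ≤ 4 * (∑' j, ‖a j‖) * Real.sin (π / (2 * n + 2)) + ∑' j, wTail a w j := by
  have hW : 0 ≤ ∑' j, ‖a j‖ := tsum_nonneg fun _ => norm_nonneg _
  have h1 : rL (blocksOf (ToepM a M) m hsum) ≤ ∑' j, ‖a j‖ := by
    refine Real.sSup_le ?_ hW
    rintro y ⟨i, j, -, rfl⟩
    exact opNorm_blocksOf_toepM_le ha hsum i j
  have h2 : rU (blocksOf (ToepM a M) m hsum) ≤ ∑' j, ‖a j‖ := by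
    refine Real.sSup_le ?_ hW
    rintro y ⟨i, j, -, rfl⟩
    exact opNorm_blocksOf_toepM_le ha hsum i j
  unfold epsTau1 rA
  refine add_le_add (mul_le_mul_of_nonneg_right (by linarith) (sin_pi_div_nonneg n))
    (opNorm_remPart_toepM_le ha hsum hw)

lemma toepShrinks_of_mem_gammaTau1 (ha : Summable fun j => ‖a j‖) (hsum : ∑ i, m i = M)
    {n w : ℕ} (hn : 1 ≤ n) (hnN : n ≤ N) (hm : ∀ i, 0 < m i)
    (hw : ∀ i, w ≤ m i) {ε η : ℝ}
    (hη : 4 * (∑' j, ‖a j‖) * Real.sin (π / (2 * n + 2)) + 3 * (∑' j, wTail a w j) < η) {z : ℂ}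
    (hz : z ∈ GammaTau1 (blocksOf (ToepM a M) m hsum) n hnN ε) : ToepShrinks a M (ε + η) z := by
  obtain ⟨x, hx, h⟩ := exists_l2_le_of_mem_gammaTau1 hn hnN hm (sub_pos.2 hη) hz
  refine (toepShrinks_iff_block a hsum _ z).2 ⟨x, hx, h.trans ?_⟩
  refine mul_le_mul_of_nonneg_right ?_ (l2_nonneg x)
  have h1 := epsTau1_toepM_le ha hsum hw n
  have h2 := opNorm_remPart_toepM_le ha hsum hw
  have h3 : 0 ≤ ∑' j, wTail a w j := tsum_nonneg (wTail_nonneg a w)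
  linarith

end ToeplitzBlocks

section Sharpness

variable {a : ℤ → ℂ}

lemma mem_gammaTau1_of_toepShrinks {N M : ℕ} {m : Fin N → ℕ} (hsum : ∑ i, m i = M) {n : ℕ}
    (hn : 1 ≤ n) (hnN : n ≤ N) {ε : ℝ} (hε : 0 ≤ ε) {z : ℂ} (h : ToepShrinks a M ε z) :
    z ∈ GammaTau1 (blocksOf (ToepM a M) m hsum) n hnN ε := by
  obtain ⟨x, hx, h⟩ := (toepShrinks_iff_block a hsum ε z).1 h
  exact mem_gammaTau1_of_l2_le hn hnN hε hx h

lemma mem_pspec_of_toepShrinks {M : ℕ} {ε : ℝ} {z : ℂ} (h : ToepShrinks a M ε z) :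
    z ∈ pspec ε (ToepM a M) := by
  obtain ⟨x, hx, h⟩ := h
  exact sval_le _ hx h

lemma toepShrinks_of_mem_pspec {M : ℕ} (hM : 0 < M) {ε η : ℝ} (hη : 0 < η) {z : ℂ}
    (h : z ∈ pspec ε (ToepM a M)) : ToepShrinks a M (ε + η) z := by
  have : Nonempty (Fin M) := ⟨⟨0, hM⟩⟩
  have h : sval (ToepM a M - z • (1 : Matrix (Fin M) (Fin M) ℂ)) < ε + η :=
    lt_of_le_of_lt h (by linarith)
  obtain ⟨x, hx, hlt⟩ := exists_of_sval_lt h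
  exact ⟨x, hx, hlt.le⟩

end Sharpness

end SpecIncl

open SpecIncl in
/-- **Theorem 5.5 (sharpness of the τ₁-method inclusion sets for Toeplitz
matrices with Wiener-algebra symbol).** Let `(a_j)` be absolutely summable
(Wiener algebra) and let `T` be the associated Toeplitz operator `A_∞` on
`ℓ²(ℕ)`. Suppose `ε > 0` (or `ε ≥ 0` if `a_{−j} = conj(a_j)` for all `j`).
Then `d_H(Spec_ε A_M, Spec_ε A_∞) → 0` as `M → ∞`; for every `δ > 0` there
exist `n₀, M₀, w₀` such that `d_H(Γ^n_ε(A_M), Spec_ε A_∞) ≤ δ` whenever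
`n ≥ n₀`, `M ≥ M₀` and `A_M` is written in block form with `N > n` and
`min_i m_i ≥ w₀`; consequently `d_H(Γ^n_ε(A_M), Spec_ε A_M) → 0` as
`M, n, w → ∞`. -/
theorem wiener_toeplitz_tau1_sharpness (a : ℤ → ℂ)
    (hWiener : Summable (fun j : ℤ => ‖a j‖))
    (T : lp (fun _ : ℕ => ℂ) 2 →L[ℂ] lp (fun _ : ℕ => ℂ) 2)
    (hT : ∀ (x : lp (fun _ : ℕ => ℂ) 2) (i : ℕ),
      (T x : ℕ → ℂ) i = ∑' j : ℕ, a ((i : ℤ) - (j : ℤ)) * (x : ℕ → ℂ) j)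
    (ε : ℝ)
    (hε : 0 < ε ∨ ((∀ j : ℤ, a (-j) = (starRingEnd ℂ) (a j)) ∧ 0 ≤ ε)) :
    Filter.Tendsto
      (fun M : ℕ => Metric.hausdorffDist (pspec ε (ToepM a M)) (pspecOp ε T))
      Filter.atTop (nhds 0) ∧
    (∀ δ : ℝ, 0 < δ → ∃ n₀ M₀ w₀ : ℕ,
      ∀ (n M N : ℕ) (m : Fin N → ℕ) (hsum : ∑ i, m i = M)
        (hN : 1 < N) (hnN : n ≤ N - 1),
        n₀ ≤ n → M₀ ≤ M → 1 ≤ n → (∀ i, 0 < m i) → (∀ i, w₀ ≤ m i) →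
        Metric.hausdorffDist
          (GammaTau1 (blocksOf (ToepM a M) m hsum) n (by omega) ε)
          (pspecOp ε T) ≤ δ) ∧
    (∀ δ : ℝ, 0 < δ → ∃ n₀ M₀ w₀ : ℕ,
      ∀ (n M N : ℕ) (m : Fin N → ℕ) (hsum : ∑ i, m i = M)
        (hN : 1 < N) (hnN : n ≤ N - 1),
        n₀ ≤ n → M₀ ≤ M → 1 ≤ n → (∀ i, 0 < m i) → (∀ i, w₀ ≤ m i) →
        Metric.hausdorffDist
          (GammaTau1 (blocksOf (ToepM a M) m hsum) n (by omega) ε)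
          (pspec ε (ToepM a M)) ≤ δ) := by
  have hε0 : 0 ≤ ε := hε.elim le_of_lt fun h => h.2
  refine ⟨?_, fun δ hδ => ?_, fun δ hδ => ?_⟩
  · rw [Metric.tendsto_atTop]
    intro δ hδ
    obtain ⟨η, hη, M₁, hup⟩ := exists_mem_pspecOp_near hWiener hT hε0 (half_pos hδ)
    obtain ⟨M₂, hlow⟩ := exists_toepShrinks_near hT hε (half_pos hδ)
    refine ⟨max (M₁ + 1) M₂, fun M hM => ?_⟩
    have hM1 : M₁ + 1 ≤ M := (le_max_left _ _).trans hM
    rw [Real.dist_eq, sub_zero, abs_of_nonneg Metric.hausdorffDist_nonneg]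
    refine lt_of_le_of_lt (Metric.hausdorffDist_le_of_mem_dist (half_pos hδ).le
      (fun z hz => ?_) (fun z hz => ?_)) (half_lt_self hδ)
    · obtain ⟨z', hz', hd⟩ := hup M (by omega) z (toepShrinks_of_mem_pspec (by omega) hη hz)
      exact ⟨z', hz', by rwa [dist_eq_norm]⟩
    · obtain ⟨z', hd, hz'⟩ := hlow M ((le_max_right _ _).trans hM) z hz
      exact ⟨z', mem_pspec_of_toepShrinks hz', by rwa [dist_eq_norm]⟩
  · obtain ⟨η, hη, M₁, hup⟩ := exists_mem_pspecOp_near hWiener hT hε0 hδ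
    obtain ⟨M₂, hlow⟩ := exists_toepShrinks_near hT hε hδ
    obtain ⟨n₀, w₀, hnw⟩ := exists_error_le hWiener hη
    refine ⟨n₀, max M₁ M₂, w₀, fun n M N m hsum hN hnN hn hM hn1 hm hw => ?_⟩
    refine Metric.hausdorffDist_le_of_mem_dist hδ.le (fun z hz => ?_) (fun z hz => ?_)
    · obtain ⟨z', hz', hd⟩ := hup M ((le_max_left _ _).trans hM) z
        (toepShrinks_of_mem_gammaTau1 hWiener hsum hn1 _ hm hw (hnw n w₀ hn le_rfl) hz)
      exact ⟨z', hz', by rwa [dist_eq_norm]⟩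
    · obtain ⟨z', hd, hz'⟩ := hlow M ((le_max_right _ _).trans hM) z hz
      exact ⟨z', mem_gammaTau1_of_toepShrinks hsum hn1 _ hε0 hz', by rwa [dist_eq_norm]⟩
  · obtain ⟨η, hη, M₁, hup⟩ := exists_mem_pspecOp_near hWiener hT hε0 (half_pos hδ)
    obtain ⟨M₂, hlow⟩ := exists_toepShrinks_near hT hε (half_pos hδ)
    obtain ⟨n₀, w₀, hnw⟩ := exists_error_le hWiener hη
    refine ⟨n₀, max (M₁ + 1) M₂, w₀, fun n M N m hsum hN hnN hn hM hn1 hm hw => ?_⟩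
    have hM1 : M₁ + 1 ≤ M := (le_max_left _ _).trans hM
    have hnear : ∀ z, ToepShrinks a M (ε + η) z →
        ∃ z', dist z z' ≤ δ ∧ ToepShrinks a M ε z' := fun z hz => by
      obtain ⟨u, hu, hd⟩ := hup M (by omega) z hz
      obtain ⟨z', hd', hz'⟩ := hlow M ((le_max_right _ _).trans hM) u hu
      refine ⟨z', ?_, hz'⟩
      rw [dist_eq_norm]
      linarith [norm_sub_le_norm_sub_add_norm_sub z u z']
    refine Metric.hausdorffDist_le_of_mem_dist hδ.le (fun z hz => ?_) (fun z hz => ?_)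
    · obtain ⟨z', hd, hz'⟩ := hnear z
        (toepShrinks_of_mem_gammaTau1 hWiener hsum hn1 _ hm hw (hnw n w₀ hn le_rfl) hz)
      exact ⟨z', mem_pspec_of_toepShrinks hz', hd⟩
    · obtain ⟨z', hd, hz'⟩ := hnear z (toepShrinks_of_mem_pspec (by omega) hη hz)
      exact ⟨z', mem_gammaTau1_of_toepShrinks hsum hn1 _ hε0 hz', hd⟩
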